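/- arXiv:math/0208172 — 2 statements merged into one kernel-verified Lean document; each statement's English description precedes it below -/
import Mathlib

section
/- Let (R,m,k) be a commutative noetherian local ring admitting a dualizing complex D^R, normalized so that H_i(D^R) = 0 for i < 0 and H_0(D^R) ≠ 0. If p is an associated prime ideal of R, then Ext^i_R(D^R, R) ≠ 0 for i = dim(R/p) − depth R. -/
open CategoryTheory CategoryTheory.Limits CochainComplex.HomComplex

noncomputable section

/-- The category of cochain complexes of `R`-modules indexed by `ℤ`.  We identify a chain
complex with homology `H_i` with the cochain complex whose cohomology in degree `n` is
`H_{-n}`. -/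
abbrev Cx (R : Type) [CommRing R] := CochainComplex (ModuleCat R) ℤ

/-- The complex consisting of the module `M` concentrated in degree `0`. -/
abbrev sgl {R : Type} [CommRing R] (M : ModuleCat R) : Cx R :=
  (HomologicalComplex.single (ModuleCat R) (ComplexShape.up ℤ) 0).obj M

/-- `π : F ⟶ M` is a semiprojective resolution of `M`:  `F` is a bounded above
complex of projective modules and `π` is a quasi-isomorphism. -/
def IsSemiprojResolution {R : Type} [CommRing R] {F M : Cx R} (π : F ⟶ M) : Prop :=
  (∀ n : ℤ, Projective (F.X n)) ∧ (∃ b : ℤ, ∀ n : ℤ, b ≤ n → IsZero (F.X n)) ∧ QuasiIso π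

/-- Vanishing of the hyper-Ext group `Ext^i(M, N)`:  computed from any semiprojective
resolution `F` of `M`, every `i`-cocycle of the Hom-complex `Hom(F, N)` is a coboundary. -/
def ExtVanishes {R : Type} [CommRing R] (M N : Cx R) (i : ℤ) : Prop :=
  ∀ (F : Cx R) (π : F ⟶ M), IsSemiprojResolution π →
    ∀ f : Cochain F N i, δ i (i+1) f = 0 → ∃ g : Cochain F N (i-1), δ (i-1) i g = f

/-- The `i`-th hyper-Ext module computed from a resolution `F` of the first variable:
the cocycles modulo the coboundaries in the Hom-complex `Hom(F, N)`. -/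
abbrev extModule (R : Type) [CommRing R] (F N : Cx R) (i : ℤ) :=
  ↥(LinearMap.ker (δ_hom R F N i (i+1))) ⧸
    (Submodule.comap (LinearMap.ker (δ_hom R F N i (i+1))).subtype
      (LinearMap.range (δ_hom R F N (i-1) i)))

/-- `Ext^i(M, N) ≅ k`, the residue field of the local ring `R`. -/
def ExtIsResidueField (R : Type) [CommRing R] [IsLocalRing R] (M N : Cx R) (i : ℤ) : Prop :=
  ∀ (F : Cx R) (π : F ⟶ M), IsSemiprojResolution π →
    Nonempty ((extModule R F N i) ≃ₗ[R] (R ⧸ IsLocalRing.maximalIdeal R))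

/-- `D` is a dualizing complex for the local ring `R`, normalized so that
`H_i(D) = 0` for `i < 0` and `H_0(D) ≠ 0` (recall `H_i(D) = H^{-i}(D)`):  it has bounded,
degreewise finitely generated homology and `Ext^i(k, D)` is `k` for exactly one `i` and
zero otherwise. -/
structure IsNormalizedDualizingComplex (R : Type) [CommRing R] [IsLocalRing R] (D : Cx R) :
    Prop where
  finite_homology : ∀ n : ℤ, Module.Finite R (D.homology n)
  homology_bounded : ∃ a : ℤ, ∀ n : ℤ, n < a → IsZero (D.homology n)
  vanish_neg : ∀ n : ℤ, 0 < n → IsZero (D.homology n)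
  nonzero_zero : ¬ IsZero (D.homology 0)
  ext_residue : ∃ d : ℤ,
    ExtIsResidueField R (sgl (ModuleCat.of R (R ⧸ IsLocalRing.maximalIdeal R))) D d ∧
    ∀ i : ℤ, i ≠ d →
      ExtVanishes (sgl (ModuleCat.of R (R ⧸ IsLocalRing.maximalIdeal R))) D i

/-- The depth of a local ring: the smallest `i` with `Ext^i(k, R) ≠ 0`. -/
def ringDepth (R : Type) [CommRing R] [IsLocalRing R] : ℕ∞ :=
  sInf { n : ℕ∞ | ∃ i : ℕ, n = i ∧
    ¬ IsZero (((Ext R (ModuleCat R) i).obj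
        (Opposite.op (ModuleCat.of R (R ⧸ IsLocalRing.maximalIdeal R)))).obj
        (ModuleCat.of R R)) }

/-- A local ring is Cohen-Macaulay if its depth equals its Krull dimension. -/
def IsCohenMacaulayLocalRing (R : Type) [CommRing R] [IsLocalRing R] : Prop :=
  (ringDepth R : WithBot ℕ∞) = ringKrullDim R

/-- `R` has finite injective dimension as a module over itself. -/
def HasFiniteSelfInjDim (R : Type) [CommRing R] : Prop :=
  ∃ n : ℕ, ∀ (M : ModuleCat R) (i : ℕ), n < i →
    IsZero (((Ext R (ModuleCat R) i).obj (Opposite.op M)).obj (ModuleCat.of R R))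

/-- A Gorenstein local ring: a noetherian local ring of finite self-injective dimension. -/
def IsGorensteinLocalRing (R : Type) [CommRing R] : Prop :=
  IsNoetherianRing R ∧ IsLocalRing R ∧ HasFiniteSelfInjDim R

/-- A commutative ring is generically Gorenstein if its localization at every
associated prime is a Gorenstein (local) ring. -/
def IsGenericallyGorenstein (R : Type) [CommRing R] : Prop :=
  ∀ (p : Ideal R) (hp : p.IsPrime), p ∈ associatedPrimes R R →
    IsGorensteinLocalRing (@Localization.AtPrime R _ p hp)

/-- A module vanishes locally at a prime `p` if each of its elements is killed by an
element outside `p`. -/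
def LocallyZero {R : Type*} [CommRing R] (p : Ideal R) (V : Type*) [AddCommGroup V]
    [Module R V] : Prop :=
  ∀ v : V, ∃ s : R, s ∉ p ∧ s • v = 0

namespace LocallyZero

variable {R : Type*} [CommRing R] {p q : Ideal R} {U V W : Type*}
  [AddCommGroup U] [Module R U] [AddCommGroup V] [Module R V] [AddCommGroup W] [Module R W]

lemma mono (h : LocallyZero p V) (hqp : q ≤ p) : LocallyZero q V := fun v ↦ by
  obtain ⟨s, hs, hv⟩ := h v
  exact ⟨s, fun h ↦ hs (hqp h), hv⟩

lemma of_equiv (h : LocallyZero p V) (e : V ≃ₗ[R] W) : LocallyZero p W := fun w ↦ by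
  obtain ⟨s, hs, hv⟩ := h (e.symm w)
  exact ⟨s, hs, by simpa using congrArg e hv⟩

lemma of_smul_eq_zero {s : R} (hs : s ∉ p) (h : ∀ v : V, s • v = 0) : LocallyZero p V :=
  fun v ↦ ⟨s, hs, h v⟩

lemma of_exact [p.IsPrime] {f : U →ₗ[R] V} {g : V →ₗ[R] W} (hfg : Function.Exact f g)
    (hU : LocallyZero p U) (hW : LocallyZero p W) : LocallyZero p V := fun v ↦ by
  obtain ⟨s, hs, hv⟩ := hW (g v)
  obtain ⟨u, hu⟩ := (hfg (s • v)).1 (by simpa using hv)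
  obtain ⟨t, ht, hu'⟩ := hU u
  exact ⟨t * s, Ideal.IsPrime.mul_notMem ‹_› ht hs, by rw [mul_smul, ← hu, ← map_smul, hu',
    map_zero]⟩

lemma exists_smul_le [p.IsPrime] [Module.Finite R V] (N : Submodule R V)
    (h : ∀ v : V, ∃ s : R, s ∉ p ∧ s • v ∈ N) : ∃ s : R, s ∉ p ∧ ∀ v : V, s • v ∈ N := by
  obtain ⟨S, hS⟩ := Module.Finite.fg_top (R := R) (M := V)
  choose s hs hsN using h
  refine ⟨∏ v ∈ S, s v, fun h ↦ ?_, fun v ↦ ?_⟩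
  · obtain ⟨v, -, hv⟩ := (Ideal.IsPrime.prod_mem_iff (p := p)).1 h
    exact hs v hv
  · have : Submodule.span R (S : Set V) ≤ N.comap (LinearMap.lsmul R V (∏ v ∈ S, s v)) := by
      rw [Submodule.span_le]
      intro v hv
      obtain ⟨c, hc⟩ := Finset.dvd_prod_of_mem s hv
      simp only [Submodule.comap_coe, Set.mem_preimage, LinearMap.lsmul_apply, SetLike.mem_coe]
      rw [hc, mul_comm, mul_smul]
      exact N.smul_mem _ (hsN v)
    rw [hS] at this
    exact this (Submodule.mem_top (x := v))

lemma exists_smul_eq_zero [p.IsPrime] [Module.Finite R V] (h : LocallyZero p V) :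
    ∃ s : R, s ∉ p ∧ ∀ v : V, s • v = 0 := by
  simpa using exists_smul_le (p := p) (⊥ : Submodule R V) (by simpa [LocallyZero] using h)

/-- A local form of Nakayama's lemma. -/
lemma of_smul_eq_smul [p.IsPrime] [Module.Finite R V] {x : R} (hx : x ∈ p)
    (h : ∀ v : V, ∃ s : R, s ∉ p ∧ ∃ w : V, s • v = x • w) : LocallyZero p V := by
  obtain ⟨s, hs, hsV⟩ := exists_smul_le (p := p) (LinearMap.range (LinearMap.lsmul R V x))
    (fun v ↦ by
      obtain ⟨s, hs, w, hw⟩ := h v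
      exact ⟨s, hs, w, hw.symm⟩)
  obtain ⟨P, hP, -, hcoeff, hP0⟩ :=
    LinearMap.exists_monic_and_natDegree_eq_and_coeff_mem_pow_and_aeval_eq_zero R
      (LinearMap.lsmul R V s) (Ideal.span {x}) (by
        rintro _ ⟨v, rfl⟩
        obtain ⟨w, hw⟩ := hsV v
        rw [LinearMap.lsmul_apply, ← hw]
        exact Submodule.smul_mem_smul (Ideal.mem_span_singleton_self x) Submodule.mem_top)
  have key : ∀ v : V, P.eval s • v = 0 := fun v ↦ by
    have h1 : (algebraMap R (Module.End R V)) s = LinearMap.lsmul R V s := by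
      ext; simp
    have := Polynomial.aeval_algebraMap_apply (Module.End R V) s P
    rw [h1, hP0] at this
    simpa [Polynomial.aeval_def] using (LinearMap.congr_fun this v).symm
  refine of_smul_eq_zero (fun hmem ↦ ?_) key
  rw [Polynomial.eval_eq_sum_range, Finset.sum_range_succ, hP.coeff_natDegree, one_mul] at hmem
  have hlow : ∑ i ∈ Finset.range P.natDegree, P.coeff i * s ^ i ∈ p := by
    refine Ideal.sum_mem _ fun i hi ↦ Ideal.mul_mem_right _ _ ?_
    have h1 := hcoeff i
    have h2 : Ideal.span {x} ^ (P.natDegree - i) ≤ p :=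
      (Ideal.pow_le_self (by have := Finset.mem_range.1 hi; omega)).trans
        ((Ideal.span_singleton_le_iff_mem p).2 hx)
    exact h2 (by simpa using h1)
  exact hs (Ideal.IsPrime.mem_of_pow_mem ‹_› _ ((Ideal.add_mem_iff_right _ hlow).1 hmem))

lemma maximalIdeal_iff [IsLocalRing R] :
    LocallyZero (IsLocalRing.maximalIdeal R) V ↔ Subsingleton V := by
  refine ⟨fun h ↦ subsingleton_of_forall_eq 0 fun v ↦ ?_, fun _ v ↦ ⟨1, ?_, Subsingleton.elim _ _⟩⟩
  · obtain ⟨s, hs, hv⟩ := h v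
    exact (IsUnit.smul_eq_zero (IsLocalRing.notMem_maximalIdeal.1 hs)).1 hv
  · exact IsLocalRing.notMem_maximalIdeal.2 isUnit_one

end LocallyZero

/-- A contravariant `R`-linear cohomological `δ`-functor on `R`-modules. -/
structure ContravariantDeltaFunctor (R : Type) [CommRing R] where
  /-- the value in degree `j` -/
  obj : ℤ → ModuleCat.{0} R → ModuleCat.{1} R
  /-- the action on morphisms -/
  map (j : ℤ) {M N : ModuleCat.{0} R} (f : M ⟶ N) : obj j N →ₗ[R] obj j M
  map_smul_id (j : ℤ) (M : ModuleCat.{0} R) (r : R) : map j (r • 𝟙 M) = r • LinearMap.id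
  /-- the connecting homomorphisms -/
  δ {S : ShortComplex (ModuleCat.{0} R)} (hS : S.ShortExact) (j : ℤ) :
    obj j S.X₁ →ₗ[R] obj (j + 1) S.X₃
  exact₁ {S : ShortComplex (ModuleCat.{0} R)} (hS : S.ShortExact) (j : ℤ) :
    Function.Exact (map j S.f) (δ hS j)
  exact₂ {S : ShortComplex (ModuleCat.{0} R)} (hS : S.ShortExact) (j : ℤ) :
    Function.Exact (map j S.g) (map j S.f)
  exact₃ {S : ShortComplex (ModuleCat.{0} R)} (hS : S.ShortExact) (j : ℤ) :
    Function.Exact (δ hS j) (map (j + 1) S.g)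

/-- The short complex attached to two linear maps with zero composition. -/
abbrev linearShortComplex {R : Type} [CommRing R] {M₁ M₂ M₃ : Type}
    [AddCommGroup M₁] [Module R M₁] [AddCommGroup M₂] [Module R M₂] [AddCommGroup M₃] [Module R M₃]
    (f : M₁ →ₗ[R] M₂) (g : M₂ →ₗ[R] M₃) (hfg : Function.Exact f g) :
    ShortComplex (ModuleCat.{0} R) :=
  ShortComplex.mk (ModuleCat.ofHom f) (ModuleCat.ofHom g) (by
    rw [← ModuleCat.ofHom_comp, hfg.linearMap_comp_eq_zero]; rfl)

lemma linearShortComplex_shortExact {R : Type} [CommRing R] {M₁ M₂ M₃ : Type}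
    [AddCommGroup M₁] [Module R M₁] [AddCommGroup M₂] [Module R M₂] [AddCommGroup M₃] [Module R M₃]
    (f : M₁ →ₗ[R] M₂) (g : M₂ →ₗ[R] M₃) (hfg : Function.Exact f g)
    (hf : Function.Injective f) (hg : Function.Surjective g) :
    (linearShortComplex f g hfg).ShortExact where
  exact := (ShortComplex.ShortExact.moduleCat_exact_iff_function_exact _).2 hfg
  mono_f := (ModuleCat.mono_iff_injective _).2 hf
  epi_g := (ModuleCat.epi_iff_surjective _).2 hg

namespace ContravariantDeltaFunctor

variable {R : Type} [CommRing R] (T : ContravariantDeltaFunctor R)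

/-- Local vanishing at `p` of the value of a `δ`-functor. -/
abbrev VanishesAt (p : Ideal R) (j : ℤ) (M : Type) [AddCommGroup M] [Module R M] : Prop :=
  LocallyZero p (T.obj j (ModuleCat.of R M))

variable {T} {p q q' : Ideal R} {M M₁ M₂ M₃ : Type} [AddCommGroup M] [Module R M]
  [AddCommGroup M₁] [Module R M₁] [AddCommGroup M₂] [Module R M₂] [AddCommGroup M₃] [Module R M₃]

lemma smul_eq_zero_of_forall {s : R} (hs : ∀ m : M, s • m = 0) (j : ℤ)
    (t : T.obj j (ModuleCat.of R M)) : s • t = 0 := by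
  have h0 : s • 𝟙 (ModuleCat.of R M) = (0 : R) • 𝟙 (ModuleCat.of R M) := by
    ext m
    simpa using hs m
  have h1 := T.map_smul_id j (ModuleCat.of R M) s
  rw [h0, T.map_smul_id] at h1
  have h2 := LinearMap.congr_fun h1 t
  rw [zero_smul] at h2
  exact h2.symm

lemma vanishesAt_of_forall {s : R} (hsp : s ∉ p) (hs : ∀ m : M, s • m = 0) (j : ℤ) :
    T.VanishesAt p j M :=
  LocallyZero.of_smul_eq_zero hsp (smul_eq_zero_of_forall hs j)

lemma vanishesAt_of_subsingleton [p.IsPrime] [Subsingleton M] (j : ℤ) : T.VanishesAt p j M :=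
  vanishesAt_of_forall (s := 1) ((Ideal.ne_top_iff_one p).1 (Ideal.IsPrime.ne_top ‹_›))
    (fun _ ↦ Subsingleton.elim _ _) j

lemma vanishesAt_quotient_of_not_le (h : ¬ q ≤ p) (j : ℤ) : T.VanishesAt p j (R ⧸ q) := by
  obtain ⟨s, hs, hsp⟩ := SetLike.not_le_iff_exists.1 h
  refine vanishesAt_of_forall hsp (fun m ↦ ?_) j
  obtain ⟨r, rfl⟩ := Ideal.Quotient.mk_surjective m
  exact Ideal.Quotient.eq_zero_iff_mem.2 (q.mul_mem_right r hs)

section Sequence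

variable [p.IsPrime] {f : M₁ →ₗ[R] M₂} {g : M₂ →ₗ[R] M₃} {j : ℤ}

lemma vanishesAt_middle (hfg : Function.Exact f g) (hf : Function.Injective f)
    (hg : Function.Surjective g) (h₁ : T.VanishesAt p j M₁)
    (h₃ : T.VanishesAt p j M₃) :
    T.VanishesAt p j M₂ :=
  LocallyZero.of_exact (T.exact₂ (linearShortComplex_shortExact f g hfg hf hg) j) h₃ h₁

lemma vanishesAt_left (hfg : Function.Exact f g) (hf : Function.Injective f)
    (hg : Function.Surjective g) (h₂ : T.VanishesAt p j M₂)
    (h₃ : T.VanishesAt p (j + 1) M₃) :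
    T.VanishesAt p j M₁ :=
  LocallyZero.of_exact (T.exact₁ (linearShortComplex_shortExact f g hfg hf hg) j) h₂ h₃

lemma vanishesAt_right (hfg : Function.Exact f g) (hf : Function.Injective f)
    (hg : Function.Surjective g) (h₁ : T.VanishesAt p j M₁)
    (h₂ : T.VanishesAt p (j + 1) M₂) :
    T.VanishesAt p (j + 1) M₃ :=
  LocallyZero.of_exact (T.exact₃ (linearShortComplex_shortExact f g hfg hf hg) j) h₁ h₂

end Sequence

lemma vanishesAt_of_equiv [p.IsPrime] (e : M₁ ≃ₗ[R] M₂) {j : ℤ} (h : T.VanishesAt p j M₁) :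
    T.VanishesAt p j M₂ :=
  vanishesAt_middle (f := e.toLinearMap) (g := (0 : M₂ →ₗ[R] PUnit.{1}))
    ((e.exact_zero_iff_surjective _).2 e.surjective) e.injective
    (Function.surjective_to_subsingleton _) h (vanishesAt_of_subsingleton j)

section SMul

variable {x : R} {g : M →ₗ[R] M₃} {j : ℤ}

lemma exact_lsmul (hxg : ∀ m, g m = 0 ↔ ∃ m', x • m' = m) :
    Function.Exact (LinearMap.lsmul R M x) g :=
  fun m ↦ hxg m

lemma injective_lsmul (hx : ∀ m : M, x • m = 0 → m = 0) :
    Function.Injective (LinearMap.lsmul R M x) := by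
  rw [← LinearMap.ker_eq_bot, LinearMap.ker_eq_bot']
  exact fun m hm ↦ hx m hm

lemma map_lsmul (t : T.obj j (ModuleCat.of R M)) :
    T.map j (ModuleCat.ofHom (LinearMap.lsmul R M x)) t = x • t := by
  have : ModuleCat.ofHom (LinearMap.lsmul R M x) = x • 𝟙 (ModuleCat.of R M) := by
    ext m; simp
  rw [this, T.map_smul_id]
  rfl

/-- If the next value of the functor vanishes locally on `M / x M`, the value on `M` does. -/
lemma vanishesAt_of_quotient [p.IsPrime] (hx : ∀ m : M, x • m = 0 → m = 0)
    (hg : Function.Surjective g) (hxg : ∀ m, g m = 0 ↔ ∃ m', x • m' = m)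
    (hxp : x ∈ p)
    (hfin : Module.Finite R (T.obj j (ModuleCat.of R M)))
    (h : T.VanishesAt p (j + 1) M₃) : T.VanishesAt p j M := by
  have hS := linearShortComplex_shortExact _ g (exact_lsmul hxg) (injective_lsmul hx) hg
  refine LocallyZero.of_smul_eq_smul hxp fun t ↦ ?_
  obtain ⟨s, hs, hst⟩ := h (T.δ hS j t)
  obtain ⟨w, hw⟩ := (T.exact₁ hS j (s • t)).1 (by rw [map_smul]; exact hst)
  exact ⟨s, hs, w, by rw [← hw]; exact map_lsmul w⟩

/-- Multiplication by `x` on the value at `M` is locally injective when the value at `M / x M`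
vanishes locally. -/
lemma exists_smul_eq_zero_of_quotient (hx : ∀ m : M, x • m = 0 → m = 0)
    (hg : Function.Surjective g) (hxg : ∀ m, g m = 0 ↔ ∃ m', x • m' = m)
    (h : T.VanishesAt p j M₃)
    (t : T.obj j (ModuleCat.of R M)) (ht : x • t = 0) : ∃ s : R, s ∉ p ∧ s • t = 0 := by
  have hS := linearShortComplex_shortExact _ g (exact_lsmul hxg) (injective_lsmul hx) hg
  obtain ⟨w, hw⟩ := (T.exact₂ hS j t).1 ((map_lsmul t).trans ht)
  obtain ⟨s, hs, hsw⟩ := h w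
  refine ⟨s, hs, ?_⟩
  rw [← hw, ← map_smul]
  exact (congrArg _ hsw).trans (map_zero _)

lemma not_vanishesAt_of_quotient [p.IsPrime] (hx : ∀ m : M, x • m = 0 → m = 0)
    (hg : Function.Surjective g) (hxg : ∀ m, g m = 0 ↔ ∃ m', x • m' = m)
    (hM : T.VanishesAt p (j + 1) M)
    (h : ¬ T.VanishesAt p (j + 1) M₃) : ¬ T.VanishesAt p j M :=
  fun hj ↦ h (vanishesAt_right (exact_lsmul hxg) (injective_lsmul hx) hg hj hM)

end SMul

/-- Dévissage to prime cyclic modules. -/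
lemma vanishesAt_of_primes [IsNoetherianRing R] [p.IsPrime] [Module.Finite R M] (j : ℤ)
    (h : ∀ r : Ideal R, r.IsPrime → Module.annihilator R M ≤ r → T.VanishesAt p j (R ⧸ r)) :
    T.VanishesAt p j M := by
  revert h
  induction ‹Module.Finite R M› using
    IsNoetherianRing.induction_on_isQuotientEquivQuotientPrime R with
  | subsingleton N => exact fun _ ↦ vanishesAt_of_subsingleton j
  | quotient N r e =>
    intro h
    refine vanishesAt_of_equiv e.symm (h r.1 r.2 ?_)
    rw [e.annihilator_eq, Ideal.annihilator_quotient]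
  | exact N₁ N₂ N₃ f g hf hg hfg h₁ h₃ =>
    intro h
    exact vanishesAt_middle hfg hf hg
      (h₁ fun r hr hle ↦ h r hr ((f.annihilator_le_of_injective hf).trans hle))
      (h₃ fun r hr hle ↦ h r hr ((g.annihilator_le_of_surjective hg).trans hle))

end ContravariantDeltaFunctor

/-- The quotient `M / x M`. -/
abbrev ModSMul {R : Type*} [CommRing R] (x : R) (M : Type*) [AddCommGroup M] [Module R M] :=
  M ⧸ LinearMap.range (LinearMap.lsmul R M x)

lemma ModSMul.mkQ_eq_zero_iff {R : Type*} [CommRing R] {x : R} {M : Type*} [AddCommGroup M]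
    [Module R M] (m : M) :
    (LinearMap.range (LinearMap.lsmul R M x)).mkQ m = 0 ↔ ∃ m', x • m' = m := by
  simp

lemma Ideal.Quotient.eq_zero_of_smul_eq_zero {R : Type*} [CommRing R] {q : Ideal R} [q.IsPrime]
    {x : R} (hx : x ∉ q) (m : R ⧸ q) (h : x • m = 0) : m = 0 := by
  obtain ⟨r, rfl⟩ := Ideal.Quotient.mk_surjective m
  have : x * r ∈ q := Ideal.Quotient.eq_zero_iff_mem.1 h
  exact Ideal.Quotient.eq_zero_iff_mem.2 ((Ideal.IsPrime.mem_or_mem ‹_› this).resolve_left hx)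

lemma ModSMul.le_annihilator {R : Type*} [CommRing R] (q : Ideal R) (x : R) :
    q ≤ Module.annihilator R (ModSMul x (R ⧸ q)) :=
  (Ideal.annihilator_quotient (I := q)).ge.trans
    ((Submodule.mkQ _).annihilator_le_of_surjective (Submodule.mkQ_surjective _))

lemma ModSMul.mem_annihilator {R : Type*} [CommRing R] (x : R) (M : Type*) [AddCommGroup M]
    [Module R M] : x ∈ Module.annihilator R (ModSMul x M) := by
  rw [Module.mem_annihilator]
  intro m
  obtain ⟨m, rfl⟩ := Submodule.mkQ_surjective _ m
  rw [← map_smul, ModSMul.mkQ_eq_zero_iff]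
  exact ⟨m, rfl⟩

namespace ContravariantDeltaFunctor

variable {R : Type} [CommRing R] {T : ContravariantDeltaFunctor R} {p q q' : Ideal R}

/-- Vanishing in high degrees on finite modules, from vanishing on the residue module. -/
lemma vanishesAt_of_lt [IsNoetherianRing R] [p.IsPrime]
    (hfin : ∀ (j : ℤ) (M : ModuleCat.{0} R), Module.Finite R M → Module.Finite R (T.obj j M))
    {n : ℤ} (hp : ∀ j, n < j → T.VanishesAt p j (R ⧸ p))
    (M : Type) [AddCommGroup M] [Module R M] [Module.Finite R M] (j : ℤ) (hj : n < j) :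
    T.VanishesAt p j M := by
  suffices H : ∀ q : Ideal R, q.IsPrime → ∀ j, n < j → T.VanishesAt p j (R ⧸ q) from
    vanishesAt_of_primes j fun r hr _ ↦ H r hr j hj
  intro q
  induction q using WellFoundedGT.induction with
  | ind q ih =>
    intro hq j hj
    by_cases hqp : q ≤ p
    · by_cases hpq : p ≤ q
      · obtain rfl := le_antisymm hqp hpq
        exact hp j hj
      · obtain ⟨x, hxp, hxq⟩ := SetLike.not_le_iff_exists.1 hpq
        refine vanishesAt_of_quotient (Ideal.Quotient.eq_zero_of_smul_eq_zero hxq)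
          (Submodule.mkQ_surjective _) ModSMul.mkQ_eq_zero_iff hxp (hfin _ _ inferInstance)
          (vanishesAt_of_primes (j + 1) fun r hr hle ↦ ih r ?_ hr _ (by omega))
        refine lt_of_le_of_ne ((ModSMul.le_annihilator q x).trans hle) ?_
        rintro rfl
        exact hxq (hle (ModSMul.mem_annihilator _ _))
    · exact vanishesAt_quotient_of_not_le hqp j

/-- Passage from a prime to a prime directly below it. -/
lemma concentrated_of_covBy [IsNoetherianRing R] [q.IsPrime] [q'.IsPrime]
    (hfin : ∀ (j : ℤ) (M : ModuleCat.{0} R), Module.Finite R M → Module.Finite R (T.obj j M))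
    (hlt : q < q') (hcov : ∀ r : Ideal R, r.IsPrime → q < r → r ≤ q' → r = q') {n : ℤ}
    (h : ∀ j, j ≠ n + 1 → T.VanishesAt q' j (R ⧸ q'))
    (hn : ¬ T.VanishesAt q' (n + 1) (R ⧸ q')) :
    (∀ j, j ≠ n → T.VanishesAt q j (R ⧸ q)) ∧ ¬ T.VanishesAt q n (R ⧸ q) := by
  have hprimes (x : R) (hx : x ∉ q) (r : Ideal R) (hr : r.IsPrime)
      (hle : Module.annihilator R (ModSMul x (R ⧸ q)) ≤ r) (j : ℤ) (hj : j ≠ n + 1) :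
      T.VanishesAt q' j (R ⧸ r) := by
    by_cases hrq : r ≤ q'
    · obtain rfl : r = q' := by
        refine hcov r hr (lt_of_le_of_ne ((ModSMul.le_annihilator q x).trans hle) ?_) hrq
        rintro rfl
        exact hx (hle (ModSMul.mem_annihilator _ _))
      exact h j hj
    · exact vanishesAt_quotient_of_not_le hrq j
  have hN (x : R) (hx : x ∉ q) (j : ℤ) (hj : j ≠ n + 1) :
      T.VanishesAt q' j (ModSMul x (R ⧸ q)) :=
    vanishesAt_of_primes j fun r hr hle ↦ hprimes x hx r hr hle j hj
  obtain ⟨x, hxq', hxq⟩ := SetLike.exists_of_lt hlt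
  have hvan (j : ℤ) (hj : j ≠ n) : T.VanishesAt q' j (R ⧸ q) :=
    vanishesAt_of_quotient (Ideal.Quotient.eq_zero_of_smul_eq_zero hxq)
      (Submodule.mkQ_surjective _) ModSMul.mkQ_eq_zero_iff hxq' (hfin _ _ inferInstance)
      (hN x hxq (j + 1) (by omega))
  have hNn : ¬ T.VanishesAt q' (n + 1) (ModSMul x (R ⧸ q)) := fun hcontra ↦ by
    let φ : R ⧸ q →ₗ[R] R ⧸ q' := Submodule.factor hlt.le
    have hφ : Function.Surjective φ := Submodule.factor_surjective hlt.le
    have hker : LinearMap.range (LinearMap.lsmul R (R ⧸ q) x) ≤ LinearMap.ker φ := by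
      rintro _ ⟨m, rfl⟩
      obtain ⟨m, rfl⟩ := Ideal.Quotient.mk_surjective m
      rw [LinearMap.mem_ker, LinearMap.lsmul_apply, map_smul]
      exact Ideal.Quotient.eq_zero_iff_mem.2 (q'.mul_mem_right m hxq')
    let ψ : ModSMul x (R ⧸ q) →ₗ[R] R ⧸ q' := Submodule.liftQ _ φ hker
    have hψ : Function.Surjective ψ := fun y ↦ by
      obtain ⟨z, hz⟩ := hφ y
      exact ⟨Submodule.mkQ _ z, hz⟩
    refine hn (vanishesAt_right (f := (LinearMap.ker ψ).subtype) (g := ψ)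
      (LinearMap.exact_subtype_ker_map ψ) (Submodule.injective_subtype _) hψ ?_ hcontra)
    exact vanishesAt_of_primes n fun r hr hle ↦ hprimes x hxq r hr
      (((LinearMap.ker ψ).subtype.annihilator_le_of_injective
        (Submodule.injective_subtype _)).trans hle) n (by omega)
  have hnon : ¬ T.VanishesAt q' n (R ⧸ q) :=
    not_vanishesAt_of_quotient (Ideal.Quotient.eq_zero_of_smul_eq_zero hxq)
      (Submodule.mkQ_surjective _) ModSMul.mkQ_eq_zero_iff (hvan (n + 1) (by omega)) hNn
  refine ⟨fun j hj ↦ (hvan j hj).mono hlt.le, fun hcontra ↦ hnon fun t ↦ ?_⟩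
  obtain ⟨s, hs, hst⟩ := hcontra t
  by_cases hs_mem : s ∈ q'
  · exact exists_smul_eq_zero_of_quotient (Ideal.Quotient.eq_zero_of_smul_eq_zero hs)
      (Submodule.mkQ_surjective _) ModSMul.mkQ_eq_zero_iff (hN s hs n (by omega)) t hst
  · exact ⟨s, hs_mem, hst⟩

/-- If the values at the residue field are concentrated in degree `d`, then the local values at
`R ⧸ p` are concentrated in degree `d - dim (R ⧸ p)`. -/
lemma concentrated_of_coheight [IsNoetherianRing R] [IsLocalRing R]
    (hfin : ∀ (j : ℤ) (M : ModuleCat.{0} R), Module.Finite R M → Module.Finite R (T.obj j M))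
    {d : ℤ} (h : ∀ j, j ≠ d →
      T.VanishesAt (IsLocalRing.maximalIdeal R) j (R ⧸ IsLocalRing.maximalIdeal R))
    (hd : ¬ T.VanishesAt (IsLocalRing.maximalIdeal R) d (R ⧸ IsLocalRing.maximalIdeal R))
    (c : ℕ) (P : PrimeSpectrum R) (hP : Order.coheight P = c) :
    (∀ j, j ≠ d - c → T.VanishesAt P.1 j (R ⧸ P.1)) ∧
      ¬ T.VanishesAt P.1 (d - c) (R ⧸ P.1) := by
  induction c generalizing P with
  | zero =>
    have hmax : P = IsLocalRing.closedPoint R :=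
      (Order.coheight_eq_zero.1 hP).eq_of_le
        (PrimeSpectrum.asIdeal_le_asIdeal _ _ |>.1
          (IsLocalRing.le_maximalIdeal P.2.ne_top))
    subst hmax
    have h0 : d - ((0 : ℕ) : ℤ) = d := by simp
    rw [h0]
    exact ⟨h, hd⟩
  | succ c ih =>
    obtain ⟨-, ⟨P', hlt, hP'⟩, hle⟩ := Order.coheight_eq_coe_add_one_iff.1 hP
    have hih := ih P' hP'
    have hdc : d - c = (d - (c + 1 : ℕ)) + 1 := by push_cast; ring
    rw [hdc] at hih
    have := P.2
    have := P'.2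
    refine concentrated_of_covBy hfin (PrimeSpectrum.asIdeal_lt_asIdeal _ _ |>.2 hlt)
      (fun r hr hqr hrq ↦ ?_) hih.1 hih.2
    by_contra hne
    have h1 : (⟨r, hr⟩ : PrimeSpectrum R) < P' :=
      lt_of_le_of_ne hrq fun h ↦ hne (congrArg PrimeSpectrum.asIdeal h)
    have h2 := Order.coheight_add_one_le h1
    have h3 := hle ⟨r, hr⟩ hqr
    rw [hP'] at h2
    have := h2.trans h3
    norm_cast at this
    omega

end ContravariantDeltaFunctor

/-- The derived-functor `Ext` and the derived-category `Ext` vanish simultaneously. -/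
lemma isZero_Ext_iff_subsingleton {R : Type} [CommRing R] (X Y : ModuleCat.{0} R) (n : ℕ) :
    IsZero (((Ext R (ModuleCat.{0} R) n).obj (Opposite.op X)).obj Y) ↔
      Subsingleton (Abelian.Ext X Y n) := by
  let P := projectiveResolution X
  have hex : IsZero (((Ext R (ModuleCat.{0} R) n).obj (Opposite.op X)).obj Y) ↔
      ∀ f : P.complex.X n ⟶ Y, P.complex.d (n + 1) n ≫ f = 0 →
        ∃ g : P.complex.X ((ComplexShape.up ℕ).prev n) ⟶ Y,
          P.complex.d n ((ComplexShape.up ℕ).prev n) ≫ g = f := by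
    rw [(P.isoExt (R := R) n Y).isZero_iff, ← HomologicalComplex.exactAt_iff_isZero_homology,
      HomologicalComplex.exactAt_iff' _ _ n (n + 1) rfl (by simp), ShortComplex.moduleCat_exact_iff]
    exact Iff.rfl
  have hzero (f : P.complex.X n ⟶ Y) (hf : P.complex.d (n + 1) n ≫ f = 0) :
      P.extMk f (n + 1) rfl hf = 0 ↔ ∃ g : P.complex.X ((ComplexShape.up ℕ).prev n) ⟶ Y,
          P.complex.d n ((ComplexShape.up ℕ).prev n) ≫ g = f := by
    cases n with
    | zero =>
      have hd : P.complex.d 0 ((ComplexShape.up ℕ).prev 0) = 0 := by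
        rw [CochainComplex.prev_nat_zero]
        exact P.complex.shape 0 0 (by simp)
      simp only [hd, zero_comp, exists_const, ← P.extEquivCohomologyClass.apply_eq_iff_eq,
        ProjectiveResolution.extEquivCohomologyClass_extMk,
        ProjectiveResolution.extEquivCohomologyClass_zero, CohomologyClass.mk_eq_zero_iff]
      rw [Cocycle.toSingleMk_mem_coboundaries_iff _ _ _ _ _ 1 (by simp)]
      have h1 : IsZero (P.cochainComplex.X 1) :=
        CochainComplex.isZero_of_isStrictlyLE P.cochainComplex 0 1 (by simp)
      constructor
      · rintro ⟨g, hg⟩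
        rw [h1.eq_of_src g 0, comp_zero] at hg
        exact ((Preadditive.IsIso.comp_left_eq_zero _ _).1 hg.symm).symm
      · rintro rfl
        exact ⟨0, by simp⟩
    | succ n =>
      rw [CochainComplex.prev_nat_succ]
      exact P.extMk_eq_zero_iff f _ rfl hf n rfl
  rw [hex]
  constructor
  · intro h
    refine subsingleton_of_forall_eq 0 fun α ↦ ?_
    obtain ⟨f, hf, rfl⟩ := P.extMk_surjective α (n + 1) rfl
    exact (hzero f hf).2 (h f hf)
  · intro h f hf
    exact (hzero f hf).1 (Subsingleton.elim _ _)

namespace ContravariantDeltaFunctor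

open scoped Pointwise

variable {R : Type} [CommRing R] {T : ContravariantDeltaFunctor R}

/-- Local duality in the critical degree: if the values at the residue field are concentrated in
degree `d`, the top nonzero value at `M` lies in degree `d - depth M`. -/
lemma top_of_ext [IsNoetherianRing R] [IsLocalRing R]
    (hfin : ∀ (j : ℤ) (M : ModuleCat.{0} R), Module.Finite R M → Module.Finite R (T.obj j M))
    {d : ℤ} (h : ∀ j, j ≠ d →
      T.VanishesAt (IsLocalRing.maximalIdeal R) j (R ⧸ IsLocalRing.maximalIdeal R))
    (hd : ¬ T.VanishesAt (IsLocalRing.maximalIdeal R) d (R ⧸ IsLocalRing.maximalIdeal R))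
    (e : ℕ) (M : ModuleCat.{0} R) [Module.Finite R M]
    (hlt : ∀ i < e, Subsingleton
      (Abelian.Ext (ModuleCat.of R (R ⧸ IsLocalRing.maximalIdeal R)) M i))
    (he : ¬ Subsingleton (Abelian.Ext (ModuleCat.of R (R ⧸ IsLocalRing.maximalIdeal R)) M e)) :
    (∀ j, d - e < j → T.VanishesAt (IsLocalRing.maximalIdeal R) j M) ∧
      ¬ T.VanishesAt (IsLocalRing.maximalIdeal R) (d - e) M := by
  induction e generalizing M with
  | zero =>
    have hd0 : d - ((0 : ℕ) : ℤ) = d := by simp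
    rw [hd0]
    refine ⟨fun j hj ↦ vanishesAt_of_lt hfin (fun j hj ↦ h j hj.ne') M j hj, fun hM ↦ hd ?_⟩
    have hne : ∃ f : (R ⧸ IsLocalRing.maximalIdeal R) →ₗ[R] M, f ≠ 0 := by
      by_contra! hcon
      refine he (Abelian.Ext.addEquiv₀.trans ModuleCat.homAddEquiv |>.subsingleton_congr.2 ?_)
      exact subsingleton_of_forall_eq 0 hcon
    obtain ⟨f, hf⟩ := hne
    have hinj : Function.Injective f := by
      have : IsSimpleModule R (R ⧸ IsLocalRing.maximalIdeal R) :=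
        isSimpleModule_iff_isCoatom.2 (IsLocalRing.maximalIdeal.isMaximal R).out
      exact f.injective_of_ne_zero hf
    exact vanishesAt_left (g := (LinearMap.range f).mkQ) (LinearMap.exact_map_mkQ_range f)
      hinj (Submodule.mkQ_surjective _) hM
      (vanishesAt_of_lt hfin (fun j hj ↦ h j hj.ne') _ _ (by omega))
  | succ e ih =>
    have hsub : Subsingleton ((R ⧸ IsLocalRing.maximalIdeal R) →ₗ[R] M) :=
      (Abelian.Ext.addEquiv₀.trans ModuleCat.homAddEquiv).subsingleton_congr.1 (hlt 0 (by omega))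
    obtain ⟨x, hxann, hx⟩ := IsSMulRegular.subsingleton_linearMap_iff.1 hsub
    rw [Ideal.annihilator_quotient] at hxann
    have hS := hx.smulShortComplex_shortExact
    have hih := ih (ModuleCat.of R (QuotSMulTop x M)) (fun i hi ↦ ?_) fun hcon ↦ he ?_
    · have hxM : ∀ m : M, x • m = 0 → m = 0 := fun m hm ↦ hx (hm.trans (smul_zero x).symm)
      have hker (m : M) : (x • (⊤ : Submodule R M)).mkQ m = 0 ↔ ∃ m', x • m' = m := by
        simp [Submodule.mem_smul_pointwise_iff_exists]
      have hd1 : d - ((e + 1 : ℕ) : ℤ) + 1 = d - e := by push_cast; ring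
      have hvan (j : ℤ) (hj : d - ((e + 1 : ℕ) : ℤ) < j) :
          T.VanishesAt (IsLocalRing.maximalIdeal R) j M :=
        vanishesAt_of_quotient hxM (Submodule.mkQ_surjective _) hker hxann (hfin _ _ ‹_›)
          (hih.1 (j + 1) (by omega))
      refine ⟨hvan, not_vanishesAt_of_quotient hxM (Submodule.mkQ_surjective _) hker
        (hvan _ (by omega)) ?_⟩
      rw [hd1]
      exact hih.2
    · have zero1 := AddCommGrpCat.isZero_of_iff_subsingleton.mpr (hlt i (by omega))
      have zero2 := AddCommGrpCat.isZero_of_iff_subsingleton.mpr (hlt (i + 1) (by omega))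
      exact AddCommGrpCat.subsingleton_of_isZero <| ShortComplex.Exact.isZero_of_both_zeros
        (Abelian.Ext.covariant_sequence_exact₃' _ hS i (i + 1) rfl)
        (zero1.eq_zero_of_src _) (zero2.eq_zero_of_tgt _)
    · have zero1 := AddCommGrpCat.isZero_of_iff_subsingleton.mpr hcon
      exact AddCommGrpCat.subsingleton_of_isZero <| ShortComplex.Exact.isZero_of_both_zeros
        (Abelian.Ext.covariant_sequence_exact₁' _ hS e (e + 1) rfl)
        (zero1.eq_zero_of_src _) (Abelian.Ext.postcomp_smul_id_eq_zero_of_mem_annihilator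
          (by rw [Ideal.annihilator_quotient]; exact hxann) (e + 1))

end ContravariantDeltaFunctor

attribute [local instance] HasDerivedCategory.standard

section DerivedDelta

variable {R : Type} [CommRing R] (X : DerivedCategory (ModuleCat.{0} R))

/-- The connecting homomorphism of `ContravariantDeltaFunctor.ofDerived`. -/
def derivedConnecting {S : ShortComplex (ModuleCat.{0} R)} (hS : S.ShortExact) (j : ℤ) :
    ((DerivedCategory.singleFunctor _ 0).obj S.X₁ ⟶ X⟦j⟧) →ₗ[R]
      ((DerivedCategory.singleFunctor _ 0).obj S.X₃ ⟶ X⟦j + 1⟧) :=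
  Linear.leftComp R _ hS.singleδ ∘ₗ
    Linear.rightComp R _ ((shiftFunctorAdd' _ j 1 (j + 1) rfl).inv.app X) ∘ₗ
      (shiftFunctor (DerivedCategory (ModuleCat.{0} R)) (1 : ℤ)).mapLinearMap R

lemma derivedConnecting_apply {S : ShortComplex (ModuleCat.{0} R)} (hS : S.ShortExact) (j : ℤ)
    (t : (DerivedCategory.singleFunctor _ 0).obj S.X₁ ⟶ X⟦j⟧) :
    derivedConnecting X hS j t =
      hS.singleδ ≫ t⟦(1 : ℤ)⟧' ≫ (shiftFunctorAdd' _ j 1 (j + 1) rfl).inv.app X := rfl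

open Pretriangulated in
lemma derived_exact₁ {S : ShortComplex (ModuleCat.{0} R)} (hS : S.ShortExact) (j : ℤ) :
    Function.Exact (Linear.leftComp R (X⟦j⟧) ((DerivedCategory.singleFunctor _ 0).map S.f))
      (derivedConnecting X hS j) := by
  intro t
  constructor
  · intro ht
    have hT := rot_of_distTriang _ (rot_of_distTriang _ hS.singleTriangle_distinguished)
    have h0 : hS.singleδ ≫ t⟦(1 : ℤ)⟧' = 0 := by
      rw [derivedConnecting_apply] at ht
      rw [← cancel_mono ((shiftFunctorAdd' _ j 1 (j + 1) rfl).inv.app X), Category.assoc,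
        zero_comp, ht]
    obtain ⟨g, hg⟩ : ∃ g : ((DerivedCategory.singleFunctor _ 0).obj S.X₂)⟦(1 : ℤ)⟧ ⟶ X⟦j⟧⟦(1 : ℤ)⟧,
        t⟦(1 : ℤ)⟧' = (-((DerivedCategory.singleFunctor _ 0).map S.f)⟦(1 : ℤ)⟧') ≫ g :=
      Triangle.yoneda_exact₂ _ hT (t⟦(1 : ℤ)⟧') h0
    obtain ⟨g', rfl⟩ := (shiftFunctor _ (1 : ℤ)).map_surjective g
    refine ⟨-g', (shiftFunctor _ (1 : ℤ)).map_injective (Eq.trans ?_ hg.symm)⟩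
    rw [Linear.leftComp_apply, Preadditive.comp_neg, Preadditive.neg_comp, Functor.map_neg,
      Functor.map_comp]
  · rintro ⟨g, rfl⟩
    rw [derivedConnecting_apply, Linear.leftComp_apply, Functor.map_comp, Category.assoc]
    have h0 : hS.singleδ ≫ ((DerivedCategory.singleFunctor _ 0).map S.f)⟦(1 : ℤ)⟧' = 0 :=
      comp_distTriang_mor_zero₃₁ _ hS.singleTriangle_distinguished
    rw [reassoc_of% h0, zero_comp]

open Pretriangulated in
lemma derived_exact₂ {S : ShortComplex (ModuleCat.{0} R)} (hS : S.ShortExact) (j : ℤ) :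
    Function.Exact (Linear.leftComp R (X⟦j⟧) ((DerivedCategory.singleFunctor _ 0).map S.g))
      (Linear.leftComp R (X⟦j⟧) ((DerivedCategory.singleFunctor _ 0).map S.f)) := by
  intro t
  constructor
  · intro ht
    obtain ⟨g, hg⟩ := Triangle.yoneda_exact₂ _ hS.singleTriangle_distinguished t ht
    exact ⟨g, hg.symm⟩
  · rintro ⟨g, rfl⟩
    rw [Linear.leftComp_apply, Linear.leftComp_apply, ← Category.assoc, ← Functor.map_comp, S.zero,
      Functor.map_zero, zero_comp]

open Pretriangulated in
lemma derived_exact₃ {S : ShortComplex (ModuleCat.{0} R)} (hS : S.ShortExact) (j : ℤ) :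
    Function.Exact (derivedConnecting X hS j)
      (Linear.leftComp R (X⟦j + 1⟧) ((DerivedCategory.singleFunctor _ 0).map S.g)) := by
  intro t
  constructor
  · intro ht
    obtain ⟨g, hg⟩ : ∃ g : ((DerivedCategory.singleFunctor _ 0).obj S.X₁)⟦(1 : ℤ)⟧ ⟶ X⟦j + 1⟧,
        t = hS.singleδ ≫ g := Triangle.yoneda_exact₃ _ hS.singleTriangle_distinguished t ht
    obtain ⟨g', hg'⟩ := (shiftFunctor _ (1 : ℤ)).map_surjective
      (g ≫ (shiftFunctorAdd' _ j 1 (j + 1) rfl).hom.app X)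
    refine ⟨g', (derivedConnecting_apply X hS j g').trans ?_⟩
    rw [hg', hg, Category.assoc, Iso.hom_inv_id_app]
    exact congrArg (hS.singleδ ≫ ·) (Category.comp_id g)
  · rintro ⟨g, rfl⟩
    have h0 : (DerivedCategory.singleFunctor _ 0).map S.g ≫ hS.singleδ = 0 :=
      comp_distTriang_mor_zero₂₃ _ hS.singleTriangle_distinguished
    rw [derivedConnecting_apply, Linear.leftComp_apply, reassoc_of% h0, zero_comp]

/-- The contravariant `δ`-functor `M ↦ Hom(M, X[j])` attached to an object `X` of the derived
category. -/
def ContravariantDeltaFunctor.ofDerived : ContravariantDeltaFunctor R where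
  obj j M := ModuleCat.of R ((DerivedCategory.singleFunctor _ 0).obj M ⟶ X⟦j⟧)
  map j M N f := Linear.leftComp R (X⟦j⟧) ((DerivedCategory.singleFunctor _ 0).map f)
  map_smul_id j M r := by
    ext t
    simp [Functor.map_smul]
  δ hS j := derivedConnecting X hS j
  exact₁ hS j := derived_exact₁ X hS j
  exact₂ hS j := derived_exact₂ X hS j
  exact₃ hS j := derived_exact₃ X hS j

end DerivedDelta

section KProjective

variable {R : Type} [CommRing R] (F L : Cx.{0} R) (n : ℤ)

/-- The class in the derived category of a cocycle. -/
def cocycleClass :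
    LinearMap.ker (δ_hom R F L n (n + 1)) →ₗ[R]
      (DerivedCategory.Q.obj F ⟶ (DerivedCategory.Q.obj L)⟦n⟧) :=
  Linear.rightComp R _ ((DerivedCategory.Q.commShiftIso n).hom.app L) ∘ₗ
    DerivedCategory.Q.mapLinearMap R ∘ₗ
      { toFun z := Cocycle.equivHomShift.symm (Cocycle.mk z.1 (n + 1) rfl z.2)
        map_add' z z' := by
          rw [← map_add]
          rfl
        map_smul' r z := by
          ext p
          simp [Cocycle.equivHomShift_symm_apply]
          rfl }

lemma cocycleClass_apply (z : LinearMap.ker (δ_hom R F L n (n + 1))) :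
    cocycleClass F L n z = DerivedCategory.Q.map
      (Cocycle.equivHomShift.symm (Cocycle.mk z.1 (n + 1) rfl z.2)) ≫
        (DerivedCategory.Q.commShiftIso n).hom.app L := rfl

lemma Q_map_eq_zero_iff {F L : Cx.{0} R} [F.IsKProjective] (φ : F ⟶ L) :
    DerivedCategory.Q.map φ = 0 ↔ (HomotopyCategory.quotient _ _).map φ = 0 := by
  have h := (DerivedCategory.quotientCompQhIso (ModuleCat.{0} R)).hom.naturality φ
  have h0 : DerivedCategory.Q.map φ = 0 ↔
      DerivedCategory.Qh.map ((HomotopyCategory.quotient _ _).map φ) = 0 := by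
    rw [← cancel_epi ((DerivedCategory.quotientCompQhIso (ModuleCat.{0} R)).hom.app F), ← h,
      comp_zero, ← zero_comp (f := (DerivedCategory.quotientCompQhIso (ModuleCat.{0} R)).hom.app L),
      cancel_mono]
    rfl
  rw [h0, ← (CochainComplex.IsKProjective.Qh_map_bijective F
    ((HomotopyCategory.quotient _ _).obj L)).injective.eq_iff, Functor.map_zero]

lemma cocycleClass_surjective [F.IsKProjective] : Function.Surjective (cocycleClass F L n) := by
  intro f
  obtain ⟨g, hg⟩ := (CochainComplex.IsKProjective.Qh_map_bijective F _).surjective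
    ((DerivedCategory.quotientCompQhIso _).hom.app F ≫ f ≫
      (DerivedCategory.Q.commShiftIso n).inv.app L ≫
        (DerivedCategory.quotientCompQhIso _).inv.app _)
  obtain ⟨g, rfl⟩ := (HomotopyCategory.quotient _ _).map_surjective g
  obtain ⟨z, rfl⟩ := Cocycle.equivHomShift.symm.surjective g
  refine ⟨⟨z.1, z.δ_eq_zero _⟩, ?_⟩
  rw [cocycleClass_apply]
  have h := (DerivedCategory.quotientCompQhIso (ModuleCat.{0} R)).hom.naturality
    (Cocycle.equivHomShift.symm z)
  have h' : DerivedCategory.Q.map (Cocycle.equivHomShift.symm z) =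
      f ≫ (DerivedCategory.Q.commShiftIso n).inv.app L := by
    rw [← cancel_epi ((DerivedCategory.quotientCompQhIso (ModuleCat.{0} R)).hom.app F), ← h]
    dsimp only [Functor.comp_map]
    rw [hg]
    simp
  exact (h' =≫ _).trans (by simp)

lemma ker_cocycleClass [F.IsKProjective] : LinearMap.ker (cocycleClass F L n) =
    Submodule.comap (LinearMap.ker (δ_hom R F L n (n + 1))).subtype
      (LinearMap.range (δ_hom R F L (n - 1) n)) := by
  ext z
  rw [LinearMap.mem_ker, cocycleClass_apply,
    ← zero_comp (f := (DerivedCategory.Q.commShiftIso n).hom.app L), cancel_mono,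
    Q_map_eq_zero_iff, ← CohomologyClass.toHom_mk, CohomologyClass.toHom_mk_eq_zero_iff,
    mem_coboundaries_iff _ (n - 1) (by simp)]
  rfl

/-- Morphisms in the derived category out of a K-projective complex are the cohomology of the
Hom-complex. -/
def extModuleEquiv [F.IsKProjective] : extModule R F L n ≃ₗ[R]
    (DerivedCategory.Q.obj F ⟶ (DerivedCategory.Q.obj L)⟦n⟧) :=
  (Submodule.quotEquivOfEq _ _ (ker_cocycleClass F L n).symm).trans
    ((cocycleClass F L n).quotKerEquivOfSurjective (cocycleClass_surjective F L n))

/-- The value at `M` of the `δ`-functor attached to a complex, computed from a K-projective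
resolution. -/
def ofDerivedEquiv [F.IsKProjective] {M : ModuleCat.{0} R} (π : F ⟶ sgl M) [QuasiIso π] :
    (ContravariantDeltaFunctor.ofDerived (DerivedCategory.Q.obj L)).obj n M ≃ₗ[R]
      extModule R F L n :=
  (Linear.homCongr R ((DerivedCategory.singleFunctorIsoCompQ _ 0).app M ≪≫
    (asIso (DerivedCategory.Q.map π)).symm) (Iso.refl _)).trans (extModuleEquiv F L n).symm

end KProjective

section RingCohomology

variable {R : Type} [CommRing R] (L : Cx.{0} R) (n : ℤ)

/-- The cohomology of a complex of modules as cocycles modulo coboundaries. -/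
def homologyEquiv : L.homology n ≃ₗ[R]
    ↥(LinearMap.ker (L.d n (n + 1)).hom) ⧸
      (LinearMap.range (L.d (n - 1) n).hom).submoduleOf (LinearMap.ker (L.d n (n + 1)).hom) :=
  (ShortComplex.homologyMapIso (L.isoSc' (n - 1) n (n + 1) (by simp) (by simp)) ≪≫
    ShortComplex.moduleCatHomologyIso _).toLinearEquiv.trans
    (Submodule.quotEquivOfEq _ _ (by
      ext z
      simp only [LinearMap.mem_range, Subtype.ext_iff]
      rfl))

/-- Evaluation at `1` of a cochain out of the ring. -/
def cochainEval : Cochain (sgl (ModuleCat.of R R)) L n ≃ₗ[R] L.X n :=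
  LinearEquiv.ofBijective
    { toFun α := ((HomologicalComplex.singleObjXSelf (.up ℤ) 0 (ModuleCat.of R R)).inv ≫
        α.v 0 n (zero_add n)).hom (1 : R)
      map_add' α β := by simp
      map_smul' r α := by simp }
    (by
      have h : Function.Bijective fun f : ModuleCat.of R R ⟶ L.X n ↦ f.hom (1 : R) :=
        ⟨fun f g hfg ↦ by
          ext
          exact hfg, fun x ↦ ⟨ModuleCat.ofHom (LinearMap.toSpanSingleton R _ x), by simp⟩⟩
      exact h.comp (Cochain.fromSingleEquiv (zero_add n)).bijective)

lemma cochainEval_apply (α : Cochain (sgl (ModuleCat.of R R)) L n) :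
    cochainEval L n α = ((HomologicalComplex.singleObjXSelf (.up ℤ) 0 (ModuleCat.of R R)).inv ≫
        α.v 0 n (zero_add n)).hom (1 : R) := rfl

variable {n} in
lemma cochainEval_δ {m : ℤ} (hnm : n + 1 = m) (α : Cochain (sgl (ModuleCat.of R R)) L n) :
    cochainEval L m (δ n m α) = (L.d n m).hom (cochainEval L n α) := by
  rw [cochainEval_apply, cochainEval_apply, δ_v n m hnm α 0 m (zero_add m) n 1 (by lia) rfl]
  simp

/-- The cohomology of the Hom-complex out of the ring. -/
def extModuleRingEquiv : extModule R (sgl (ModuleCat.of R R)) L n ≃ₗ[R] L.homology n :=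
  (Submodule.Quotient.equiv _ _ ((cochainEval L n).ofSubmodules _
    (LinearMap.ker (L.d n (n + 1)).hom) (by
      ext x
      obtain ⟨α, rfl⟩ := (cochainEval L n).surjective x
      have h := cochainEval_δ L (rfl : n + 1 = n + 1) α
      simp [← h])) (by
      ext x
      constructor
      · rintro ⟨z, ⟨β, hβ⟩, rfl⟩
        exact ⟨cochainEval L (n - 1) β, (cochainEval_δ L (sub_add_cancel n 1) β).symm.trans
          (congrArg (cochainEval L n) hβ)⟩
      · rintro ⟨y, hy⟩
        obtain ⟨β, rfl⟩ := (cochainEval L (n - 1)).surjective y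
        have hβ := (cochainEval_δ L (sub_add_cancel n 1) β).trans hy
        refine ⟨⟨δ (n - 1) n β, δ_δ _ _ _ β⟩, ⟨β, rfl⟩, Subtype.ext hβ⟩)).trans
    (homologyEquiv L n).symm

end RingCohomology

namespace ContravariantDeltaFunctor

variable {R : Type} [CommRing R] {T : ContravariantDeltaFunctor R}

lemma subsingleton_obj (M : Type) [AddCommGroup M] [Module R M] [Subsingleton M] (j : ℤ) :
    Subsingleton (T.obj j (ModuleCat.of R M)) :=
  subsingleton_of_forall_eq 0 fun t ↦ by
    rw [← one_smul R t]
    exact smul_eq_zero_of_forall (fun _ ↦ Subsingleton.elim _ _) j t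

lemma finite_middle [IsNoetherianRing R] {M₁ M₂ M₃ : Type} [AddCommGroup M₁] [Module R M₁]
    [AddCommGroup M₂] [Module R M₂] [AddCommGroup M₃] [Module R M₃]
    {f : M₁ →ₗ[R] M₂} {g : M₂ →ₗ[R] M₃} (hfg : Function.Exact f g)
    (hf : Function.Injective f) (hg : Function.Surjective g) {j : ℤ}
    (h₁ : Module.Finite R (T.obj j (ModuleCat.of R M₁)))
    (h₃ : Module.Finite R (T.obj j (ModuleCat.of R M₃))) :
    Module.Finite R (T.obj j (ModuleCat.of R M₂)) := by
  have h := T.exact₂ (linearShortComplex_shortExact f g hfg hf hg) j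
  have : IsNoetherian R (T.obj j (ModuleCat.of R M₂)) :=
    isNoetherian_of_range_eq_ker (M := T.obj j (ModuleCat.of R M₃))
      (P := T.obj j (ModuleCat.of R M₁)) _ _ h.linearMap_ker_eq.symm
  infer_instance

lemma finite_right [IsNoetherianRing R] {M₁ M₂ M₃ : Type} [AddCommGroup M₁] [Module R M₁]
    [AddCommGroup M₂] [Module R M₂] [AddCommGroup M₃] [Module R M₃]
    {f : M₁ →ₗ[R] M₂} {g : M₂ →ₗ[R] M₃} (hfg : Function.Exact f g)
    (hf : Function.Injective f) (hg : Function.Surjective g) {j : ℤ}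
    (h₁ : Module.Finite R (T.obj j (ModuleCat.of R M₁)))
    (h₂ : Module.Finite R (T.obj (j + 1) (ModuleCat.of R M₂))) :
    Module.Finite R (T.obj (j + 1) (ModuleCat.of R M₃)) := by
  have h := T.exact₃ (linearShortComplex_shortExact f g hfg hf hg) j
  have : IsNoetherian R (T.obj (j + 1) (ModuleCat.of R M₃)) :=
    isNoetherian_of_range_eq_ker (M := T.obj j (ModuleCat.of R M₁))
      (P := T.obj (j + 1) (ModuleCat.of R M₂)) _ _ h.linearMap_ker_eq.symm
  infer_instance

/-- A `δ`-functor which vanishes in low degrees and has finite values on the ring has finite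
values on all finite modules. -/
lemma finite_obj [IsNoetherianRing R] {a : ℤ}
    (ha : ∀ j < a, ∀ M : ModuleCat.{0} R, Subsingleton (T.obj j M))
    (hR : ∀ j, Module.Finite R (T.obj j (ModuleCat.of R R)))
    (j : ℤ) (M : ModuleCat.{0} R) (hM : Module.Finite R M) : Module.Finite R (T.obj j M) := by
  suffices H : ∀ n : ℕ, ∀ (M : Type) [AddCommGroup M] [Module R M] [Module.Finite R M],
      Module.Finite R (T.obj (a - 1 + n) (ModuleCat.of R M)) by
    by_cases hj : j < a
    · have := ha j hj M
      infer_instance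
    · obtain ⟨n, hn⟩ := Int.eq_ofNat_of_zero_le (show 0 ≤ j - (a - 1) by omega)
      obtain rfl : j = a - 1 + n := by omega
      exact H n M
  intro n
  induction n with
  | zero =>
    intro M _ _ _
    have := ha (a - 1 + (0 : ℕ)) (by simp) (ModuleCat.of R M)
    infer_instance
  | succ n ih =>
    intro M _ _ _
    have hn : a - 1 + ((n + 1 : ℕ) : ℤ) = a - 1 + n + 1 := by push_cast; ring
    rw [hn]
    induction ‹Module.Finite R M› using
      IsNoetherianRing.induction_on_isQuotientEquivQuotientPrime R with
    | subsingleton N =>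
      have := subsingleton_obj (T := T) N (a - 1 + n + 1)
      infer_instance
    | quotient N r e =>
      have := subsingleton_obj (R := R) (T := T) PUnit.{1} (a - 1 + n + 1)
      exact finite_middle (f := e.symm.toLinearMap) (g := (0 : N →ₗ[R] PUnit.{1}))
        ((e.symm.exact_zero_iff_surjective _).2 e.symm.surjective) e.symm.injective
        (Function.surjective_to_subsingleton _)
        (finite_right (f := r.1.subtype) (g := r.1.mkQ) (LinearMap.exact_subtype_mkQ _)
          (Submodule.subtype_injective _) (Submodule.mkQ_surjective _) (ih _) (hR _))
        inferInstance
    | exact N₁ N₂ N₃ f g hf hg hfg h₁ h₃ => exact finite_middle hfg hf hg h₁ h₃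

end ContravariantDeltaFunctor

section Values

variable {R : Type} [CommRing R] (L : Cx.{0} R)

/-- The value of the derived `δ`-functor at the ring is cohomology. -/
def ofDerivedRingEquiv (n : ℤ) :
    (ContravariantDeltaFunctor.ofDerived (DerivedCategory.Q.obj L)).obj n (ModuleCat.of R R) ≃ₗ[R]
      L.homology n :=
  have : ∀ i, Projective ((sgl (ModuleCat.of R R)).X i) := fun i ↦ by
    by_cases hi : i = 0
    · subst hi
      exact Projective.of_iso (HomologicalComplex.singleObjXSelf (.up ℤ) 0 (ModuleCat.of R R)).symm
        ((IsProjective.iff_projective R).1 inferInstance)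
    · exact (HomologicalComplex.isZero_single_obj_X _ _ _ _ hi).projective
  have : (sgl (ModuleCat.of R R)).IsKProjective := CochainComplex.isKProjective_of_projective _ 0
  (ofDerivedEquiv _ L n (𝟙 (sgl (ModuleCat.of R R)))).trans (extModuleRingEquiv L n)

lemma ofDerived_subsingleton {a : ℤ} (ha : ∀ n < a, IsZero (L.homology n)) (j : ℤ) (hj : j < a)
    (M : ModuleCat.{0} R) :
    Subsingleton ((ContravariantDeltaFunctor.ofDerived (DerivedCategory.Q.obj L)).obj j M) := by
  have : L.IsGE a := (CochainComplex.isGE_iff _ _).2 fun i hi ↦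
    (HomologicalComplex.exactAt_iff_isZero_homology _ _).2 (ha i hi)
  have : ((DerivedCategory.Q.obj L)⟦j⟧).IsGE (a - j) :=
    DerivedCategory.TStructure.t.isGE_shift _ a j (a - j)
  exact subsingleton_of_forall_eq 0 fun f ↦
    DerivedCategory.TStructure.t.zero_of_isLE_of_isGE f 0 (a - j) (by omega) inferInstance this

end Values

section ResidueField

variable {R : Type} [CommRing R]

lemma isSemiprojResolution_of_projectiveResolution {M : ModuleCat.{0} R}
    (P : ProjectiveResolution M) :
    IsSemiprojResolution (F := P.cochainComplex) (M := sgl M) P.π' :=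
  ⟨inferInstance, ⟨1, fun n hn ↦ CochainComplex.isZero_of_isStrictlyLE _ 0 _ (by omega)⟩,
    show QuasiIso P.π' from inferInstance⟩

/-- The values of the derived `δ`-functor computed from a projective resolution. -/
def ofDerivedEquivOfProjectiveResolution (L : Cx.{0} R) (n : ℤ) {M : ModuleCat.{0} R}
    (P : ProjectiveResolution M) :
    (ContravariantDeltaFunctor.ofDerived (DerivedCategory.Q.obj L)).obj n M ≃ₗ[R]
      extModule R P.cochainComplex L n :=
  have : QuasiIso (show P.cochainComplex ⟶ sgl M from P.π') :=
    inferInstanceAs (QuasiIso P.π')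
  ofDerivedEquiv P.cochainComplex L n (show P.cochainComplex ⟶ sgl M from P.π')

lemma ofDerived_subsingleton_of_extVanishes {L : Cx.{0} R} {n : ℤ} {M : ModuleCat.{0} R}
    (h : ExtVanishes (sgl M) L n) :
    Subsingleton ((ContravariantDeltaFunctor.ofDerived (DerivedCategory.Q.obj L)).obj n M) := by
  let P := projectiveResolution M
  have : Subsingleton (extModule R P.cochainComplex L n) := by
    rw [Submodule.Quotient.subsingleton_iff, Submodule.comap_subtype_eq_top]
    exact fun f hf ↦ h _ _ (isSemiprojResolution_of_projectiveResolution P) f hf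
  exact (ofDerivedEquivOfProjectiveResolution L n P).subsingleton

lemma nonempty_ofDerived_equiv_of_extIsResidueField [IsLocalRing R] {L : Cx.{0} R} {n : ℤ}
    {M : ModuleCat.{0} R} (h : ExtIsResidueField R (sgl M) L n) :
    Nonempty ((ContravariantDeltaFunctor.ofDerived (DerivedCategory.Q.obj L)).obj n M ≃ₗ[R]
      (R ⧸ IsLocalRing.maximalIdeal R)) := by
  let P := projectiveResolution M
  obtain ⟨e⟩ := h _ _ (isSemiprojResolution_of_projectiveResolution P)
  exact ⟨(ofDerivedEquivOfProjectiveResolution L n P).trans e⟩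

end ResidueField

section Resolution

lemma quasiIso_of_op {C : Type*} [Category* C] [Abelian C] {K L : CochainComplex C ℤ} (φ : K ⟶ L)
    (h : QuasiIso ((CochainComplex.opEquivalence C).functor.map φ.op)) : QuasiIso φ := by
  rw [quasiIso_iff]
  intro n
  obtain ⟨n, rfl⟩ : ∃ m, n = -m := ⟨-n, by simp⟩
  have hn := h.quasiIsoAt n
  rw [quasiIsoAt_iff' _ (n - 1) n (n + 1) (by simp) (by simp)] at hn
  rw [quasiIsoAt_iff' _ (-(n + 1)) (-n) (-(n - 1)) (by simp; ring) (by simp; ring),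
    ← ShortComplex.quasiIso_opMap_iff]
  exact hn

/-- A complex with bounded above cohomology has a semiprojective resolution. -/
lemma exists_isSemiprojResolution {R : Type} [CommRing R] (D : Cx.{0} R) (b : ℤ)
    (hb : ∀ n, b < n → IsZero (D.homology n)) :
    ∃ (F : Cx.{0} R) (π : F ⟶ D), IsSemiprojResolution π := by
  have : D.IsLE b := (CochainComplex.isLE_iff _ _).2 fun i hi ↦
    (HomologicalComplex.exactAt_iff_isZero_homology _ _).2 (hb i hi)
  let K := D.truncLE b
  let E := CochainComplex.opEquivalence (ModuleCat.{0} R)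
  have : (E.functor.obj (Opposite.op K)).IsStrictlyGE (-b) := by
    rw [CochainComplex.isStrictlyGE_iff]
    intro i hi
    exact (K.isZero_of_isStrictlyLE b (-i) (by omega)).op
  obtain ⟨L, i, hi, hL, hL'⟩ := CochainComplex.Plus.modelCategoryQuillen.exists_quasiIso_injective
    (E.functor.obj (Opposite.op K)) (-b)
  let F := (E.inverse.obj L).unop
  let e : E.functor.obj (Opposite.op F) ≅ L := E.counitIso.app L
  let φ := (E.functor.preimage (i ≫ e.inv)).unop
  have hφ : QuasiIso φ := quasiIso_of_op φ (by
    change QuasiIso (E.functor.map (E.functor.preimage (i ≫ e.inv)))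
    rw [E.functor.map_preimage]
    infer_instance)
  let e' (n : ℤ) : Opposite.op (F.X (-n)) ≅ L.X n :=
    (HomologicalComplex.eval _ _ n).mapIso e
  refine ⟨F, φ ≫ D.ιTruncLE b, fun n ↦ ?_, ⟨b + 1, fun n hn ↦ ?_⟩, inferInstance⟩
  · obtain ⟨n, rfl⟩ : ∃ m, n = -m := ⟨-n, by simp⟩
    have : Injective (Opposite.op (F.X (-n))) := Injective.of_iso (e' n).symm (hL n)
    exact Injective.projective_iff_injective_op.2 this
  · obtain ⟨n, rfl⟩ : ∃ m, n = -m := ⟨-n, by simp⟩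
    exact (((L.isZero_of_isStrictlyGE (-b) n (by omega)).of_iso (e' n))).unop

end Resolution

section Cocycle

variable {R : Type} [CommRing R] (F : Cx.{0} R)

lemma d_hom_d_hom (i j k : ℤ) (x : F.X i) : (F.d j k).hom ((F.d i j).hom x) = 0 := by
  rw [← LinearMap.comp_apply, ← ModuleCat.hom_comp, F.d_comp_d]
  rfl

variable {F} {p : Ideal R} [p.IsPrime]

lemma exists_smul_mem_range {i j k : ℤ} (hij : i + 1 = j) (hjk : j + 1 = k)
    (hfin : Module.Finite R (F.homology j)) (h : LocallyZero p (F.homology j)) :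
    ∃ s : R, s ∉ p ∧ ∀ x : F.X j, (F.d j k).hom x = 0 → s • x ∈ LinearMap.range (F.d i j).hom := by
  obtain rfl : i = j - 1 := by omega
  subst hjk
  obtain ⟨s, hs, h0⟩ := h.exists_smul_eq_zero
  refine ⟨s, hs, fun x hx ↦ ?_⟩
  have h1 := congrArg (homologyEquiv F j) (h0 ((homologyEquiv F j).symm
    (Submodule.Quotient.mk ⟨x, hx⟩)))
  rw [map_smul, LinearEquiv.apply_symm_apply, map_zero, ← Submodule.Quotient.mk_smul,
    Submodule.Quotient.mk_eq_zero] at h1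
  exact h1

/-- If the cohomology of a bounded above complex of projective modules vanishes locally at `p`
in all degrees above `n`, then the differential in degree `n` splits up to an element outside
`p`. -/
lemma exists_section_up_to_smul [∀ i, Module.Projective R (F.X i)] {b n : ℤ}
    (hb : ∀ i, b ≤ i → IsZero (F.X i)) (hfin : ∀ i, Module.Finite R (F.homology i))
    (h : ∀ i, n < i → LocallyZero p (F.homology i)) (m : ℤ) (hm : n ≤ m) :
    ∃ s : R, s ∉ p ∧ ∃ ρ : F.X (m + 1) →ₗ[R] F.X m, ∀ x : F.X m,
      (F.d m (m + 1)).hom (ρ ((F.d m (m + 1)).hom x)) = s • (F.d m (m + 1)).hom x := by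
  obtain ⟨k, hk⟩ : ∃ k : ℕ, b ≤ m + k := ⟨(b - m).toNat, by omega⟩
  induction k generalizing m with
  | zero =>
    have : Subsingleton (F.X m) := ModuleCat.subsingleton_of_isZero (hb m (by simpa using hk))
    exact ⟨1, p.one_notMem, 0, fun x ↦ by simp [Subsingleton.elim x 0]⟩
  | succ k ih =>
    obtain ⟨s, hs, ρ, hρ⟩ := ih (m + 1) (by omega) (by push_cast at hk; omega)
    obtain ⟨t, ht, htr⟩ := exists_smul_mem_range (rfl : m + 1 = m + 1) rfl (hfin (m + 1))
      (h (m + 1) (by omega))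
    let u : F.X (m + 1) →ₗ[R] LinearMap.range (F.d m (m + 1)).hom :=
      LinearMap.codRestrict _ (t • (s • LinearMap.id - ρ ∘ₗ (F.d (m + 1) (m + 1 + 1)).hom))
        fun x ↦ htr _ (by simp [hρ])
    obtain ⟨σ, hσ⟩ := Module.projective_lifting_property (F.d m (m + 1)).hom.rangeRestrict u
      (LinearMap.surjective_rangeRestrict _)
    refine ⟨t * s, Ideal.IsPrime.mul_notMem ‹_› ht hs, σ, fun x ↦ ?_⟩
    have := congrArg Subtype.val (LinearMap.congr_fun hσ ((F.d m (m + 1)).hom x))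
    simpa [u, d_hom_d_hom, mul_smul] using this

lemma LocallyZero.exists_linearMap_ne_zero [IsNoetherianRing R] {V : Type*} [AddCommGroup V]
    [Module R V] [Module.Finite R V] (h : ¬ LocallyZero p V) :
    ∃ f : V →ₗ[R] R ⧸ p, f ≠ 0 := by
  by_contra! hcon
  obtain ⟨x, hx, hreg⟩ := IsSMulRegular.subsingleton_linearMap_iff.1
    (subsingleton_of_forall_eq 0 hcon)
  refine h (of_smul_eq_zero (fun hxp ↦ ?_) (Module.mem_annihilator.1 hx))
  have h0 : x • (1 : R ⧸ p) = x • (0 : R ⧸ p) := by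
    rw [smul_zero]
    exact (Algebra.smul_def x (1 : R ⧸ p)).trans (by
      simpa using Ideal.Quotient.eq_zero_iff_mem.2 hxp)
  exact one_ne_zero (hreg h0)

lemma exists_cocycle [IsNoetherianRing R] [∀ i, Module.Projective R (F.X i)] {b n : ℤ}
    (hb : ∀ i, b ≤ i → IsZero (F.X i)) (hfin : ∀ i, Module.Finite R (F.homology i))
    (h : ∀ i, n < i → LocallyZero p (F.homology i)) (hn : ¬ LocallyZero p (F.homology n))
    (ι : (R ⧸ p) →ₗ[R] R) (hι : Function.Injective ι) :
    ∃ f : F.X n →ₗ[R] R, (∀ x : F.X (n - 1), f ((F.d (n - 1) n).hom x) = 0) ∧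
      ∃ z : F.X n, (F.d n (n + 1)).hom z = 0 ∧ f z ≠ 0 := by
  obtain ⟨s, hs, ρ, hρ⟩ := exists_section_up_to_smul hb hfin h n le_rfl
  have := hfin n
  obtain ⟨g, hg⟩ := LocallyZero.exists_linearMap_ne_zero hn
  let u : F.X n →ₗ[R] LinearMap.ker (F.d n (n + 1)).hom :=
    LinearMap.codRestrict _ (s • LinearMap.id - ρ ∘ₗ (F.d n (n + 1)).hom) fun x ↦ by simp [hρ]
  have hu (z : F.X n) (hz : (F.d n (n + 1)).hom z = 0) : u z = s • ⟨z, hz⟩ := by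
    ext
    simp [u, hz]
  let q := (homologyEquiv F n).symm.toLinearMap ∘ₗ Submodule.mkQ _
  have hq : Function.Surjective q :=
    (homologyEquiv F n).symm.surjective.comp (Submodule.mkQ_surjective _)
  refine ⟨ι ∘ₗ g ∘ₗ q ∘ₗ u, fun x ↦ ?_, ?_⟩
  · have h0 : q ⟨(F.d (n - 1) n).hom x, d_hom_d_hom F _ _ _ x⟩ = 0 := by
      simp only [q, LinearMap.comp_apply, LinearEquiv.coe_coe, Submodule.mkQ_apply]
      rw [(Submodule.Quotient.mk_eq_zero _).2, map_zero]
      exact ⟨x, rfl⟩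
    simp [hu _ (d_hom_d_hom F _ _ _ x), h0]
  · obtain ⟨v, hv⟩ := DFunLike.ne_iff.1 hg
    obtain ⟨⟨z, hz⟩, rfl⟩ := hq v
    refine ⟨z, hz, fun h0 ↦ hv ?_⟩
    simp only [LinearMap.comp_apply, hu z hz, map_smul] at h0
    exact Ideal.Quotient.eq_zero_of_smul_eq_zero hs _ (hι (by simpa using h0))

/-- A functional on `F.X n` that vanishes on coboundaries but not on cocycles represents a nonzero
class in the cohomology of the Hom-complex. -/
lemma not_extVanishes_of_functional {M : Cx.{0} R} {π : F ⟶ M} (hπ : IsSemiprojResolution π)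
    {n i : ℤ} (hi : i = -n) (f : F.X n →ₗ[R] R)
    (hf : ∀ x : F.X (n - 1), f ((F.d (n - 1) n).hom x) = 0) (z : F.X n)
    (hz : (F.d n (n + 1)).hom z = 0) (hfz : f z ≠ 0) :
    ¬ ExtVanishes M (sgl (ModuleCat.of R R)) i := by
  intro hM
  let α : Cochain F (sgl (ModuleCat.of R R)) i :=
    Cochain.toSingleMk (ModuleCat.ofHom f) (by omega : n + i = 0)
  have hα : δ i (i + 1) α = 0 := by
    refine (Cochain.δ_toSingleMk (ModuleCat.ofHom f) (by omega : n + i = 0) (i + 1) (n - 1)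
      (by omega)).trans ?_
    have : F.d (n - 1) n ≫ ModuleCat.ofHom f = 0 := by
      ext x
      exact hf x
    rw [this, Cochain.toSingleMk_zero, smul_zero]
    rfl
  obtain ⟨g, hg⟩ := hM F π hπ α hα
  obtain ⟨g, rfl⟩ := Cochain.toSingleMk_surjective (q := 0) g (n + 1) (by omega)
  have h1 := (Cochain.δ_toSingleMk g (by omega : n + 1 + (i - 1) = 0) i n (by omega)).symm.trans hg
  have h2 := congrArg (Cochain.toSingleEquiv (by omega : n + i = 0)) h1
  rw [Units.smul_def, map_zsmul, Cochain.toSingleEquiv_toSingleMk] at h2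
  have h3 : _ = ModuleCat.ofHom f := h2.trans (Cochain.toSingleEquiv_toSingleMk _ _)
  have h4 := congrArg (fun φ ↦ φ.hom z) h3
  simp [hz] at h4
  exact hfz h4.symm

end Cocycle

lemma coheight_eq_of_ringKrullDim_quotient {R : Type*} [CommRing R] (P : PrimeSpectrum R) {d : ℕ}
    (hd : (d : WithBot ℕ∞) = ringKrullDim (R ⧸ P.asIdeal)) : Order.coheight P = d := by
  rw [ringKrullDim_quotient] at hd
  have h : (Order.coheight P : WithBot ℕ∞) = d := by
    rw [Order.coheight_eq_krullDim_Ici, hd]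
    rfl
  exact_mod_cast h

lemma exists_injective_of_mem_associatedPrimes {R : Type*} [CommRing R] [IsNoetherianRing R]
    {p : Ideal R} (hp : p ∈ associatedPrimes R R) :
    ∃ ι : (R ⧸ p) →ₗ[R] R, Function.Injective ι := by
  obtain ⟨-, a, rfl⟩ := isAssociatedPrime_iff.1 hp
  have h : Submodule.colon ⊥ {a} = LinearMap.ker (LinearMap.toSpanSingleton R R a) := by
    ext r
    simp [Submodule.mem_colon_singleton]
  refine ⟨Submodule.liftQ _ (LinearMap.toSpanSingleton R R a) h.le, ?_⟩
  exact LinearMap.ker_eq_bot.1 (Submodule.ker_liftQ_eq_bot _ _ _ h.ge)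

lemma ext_of_eq_ringDepth {R : Type} [CommRing R] [IsLocalRing R] {e : ℕ}
    (he : (e : ℕ∞) = ringDepth R) :
    (∀ i < e, Subsingleton (Abelian.Ext
      (ModuleCat.of R (R ⧸ IsLocalRing.maximalIdeal R)) (ModuleCat.of R R) i)) ∧
    ¬ Subsingleton (Abelian.Ext
      (ModuleCat.of R (R ⧸ IsLocalRing.maximalIdeal R)) (ModuleCat.of R R) e) := by
  simp only [← isZero_Ext_iff_subsingleton]
  refine ⟨fun i hi ↦ ?_, ?_⟩
  · by_contra hcon
    have : ringDepth R ≤ i := sInf_le ⟨i, rfl, hcon⟩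
    rw [← he] at this
    exact absurd (by exact_mod_cast this) hi.not_ge
  · have hne : { n : ℕ∞ | ∃ i : ℕ, n = i ∧
        ¬ IsZero (((Ext R (ModuleCat R) i).obj
          (Opposite.op (ModuleCat.of R (R ⧸ IsLocalRing.maximalIdeal R)))).obj
          (ModuleCat.of R R)) }.Nonempty := by
      by_contra! hcon
      rw [ringDepth, hcon, sInf_empty] at he
      exact ENat.natCast_ne_top e he
    obtain ⟨i, hi, hi'⟩ := csInf_mem hne
    obtain rfl : e = i := by exact_mod_cast he.trans hi
    exact hi'

namespace IsNormalizedDualizingComplex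

variable {R : Type} [CommRing R] [IsNoetherianRing R] [IsLocalRing R] {D : Cx.{0} R}

lemma finite_ofDerived (hD : IsNormalizedDualizingComplex R D)
    (j : ℤ) (M : ModuleCat.{0} R) (hM : Module.Finite R M) :
    Module.Finite R ((ContravariantDeltaFunctor.ofDerived (DerivedCategory.Q.obj D)).obj j M) := by
  obtain ⟨a, ha⟩ := hD.homology_bounded
  refine ContravariantDeltaFunctor.finite_obj (a := a)
    (fun j hj M ↦ ofDerived_subsingleton D ha j hj M) (fun j ↦ ?_) j M hM
  have := hD.finite_homology j
  exact Module.Finite.equiv (ofDerivedRingEquiv D j).symm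

/-- The degree of the nonzero module `Ext(k, D)` is the depth of the ring. -/
lemma vanishesAt_maximalIdeal_iff (hD : IsNormalizedDualizingComplex R D)
    {e : ℕ} (he : (e : ℕ∞) = ringDepth R) (j : ℤ) :
    (ContravariantDeltaFunctor.ofDerived (DerivedCategory.Q.obj D)).VanishesAt
      (IsLocalRing.maximalIdeal R) j (R ⧸ IsLocalRing.maximalIdeal R) ↔ j ≠ e := by
  obtain ⟨d, hd, hd'⟩ := hD.ext_residue
  have h1 (j : ℤ) (hj : j ≠ d) : (ContravariantDeltaFunctor.ofDerived
      (DerivedCategory.Q.obj D)).VanishesAt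
      (IsLocalRing.maximalIdeal R) j (R ⧸ IsLocalRing.maximalIdeal R) :=
    LocallyZero.maximalIdeal_iff.2 (ofDerived_subsingleton_of_extVanishes (hd' j hj))
  have h2 : ¬ (ContravariantDeltaFunctor.ofDerived (DerivedCategory.Q.obj D)).VanishesAt
      (IsLocalRing.maximalIdeal R) d (R ⧸ IsLocalRing.maximalIdeal R) := by
    obtain ⟨φ⟩ := nonempty_ofDerived_equiv_of_extIsResidueField hd
    exact fun h ↦ not_subsingleton (R ⧸ IsLocalRing.maximalIdeal R)
      (φ.toEquiv.subsingleton_congr.1 (LocallyZero.maximalIdeal_iff.1 h))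
  obtain ⟨hlt, hee⟩ := ext_of_eq_ringDepth he
  obtain ⟨h3, h4⟩ := ContravariantDeltaFunctor.top_of_ext hD.finite_ofDerived h1 h2 e
    (ModuleCat.of R R) hlt hee
  have hiff (j : ℤ) : (ContravariantDeltaFunctor.ofDerived (DerivedCategory.Q.obj D)).VanishesAt
      (IsLocalRing.maximalIdeal R) j R ↔ IsZero (D.homology j) :=
    LocallyZero.maximalIdeal_iff.trans
      ((ofDerivedRingEquiv D j).toEquiv.subsingleton_congr.trans
        ModuleCat.isZero_iff_subsingleton.symm)
  have hde : d = e := by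
    have h5 : ¬ d - e < 0 := fun h ↦ hD.nonzero_zero ((hiff 0).1 (h3 0 h))
    have h6 : ¬ 0 < d - e := fun h ↦ h4 ((hiff _).2 (hD.vanish_neg _ h))
    omega
  subst hde
  exact ⟨fun h hj ↦ h2 (hj ▸ h), h1 j⟩

/-- The top degree in which the cohomology of a dualizing complex is supported at an associated
prime of the ring. -/
lemma locallyZero_homology (hD : IsNormalizedDualizingComplex R D)
    {e d : ℕ} (he : (e : ℕ∞) = ringDepth R) (p : Ideal R)
    (hp : p ∈ associatedPrimes R R) (hd : (d : WithBot ℕ∞) = ringKrullDim (R ⧸ p)) :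
    (∀ j : ℤ, (e : ℤ) - d < j → LocallyZero p (D.homology j)) ∧
      ¬ LocallyZero p (D.homology ((e : ℤ) - d)) := by
  have : p.IsPrime := IsAssociatedPrime.isPrime hp
  obtain ⟨h1, h2⟩ := ContravariantDeltaFunctor.concentrated_of_coheight hD.finite_ofDerived
    (d := e) (fun j hj ↦ (hD.vanishesAt_maximalIdeal_iff he j).2 hj)
    (fun h ↦ (hD.vanishesAt_maximalIdeal_iff he e).1 h rfl) d ⟨p, this⟩
    (coheight_eq_of_ringKrullDim_quotient _ hd)
  have h3 (M : Type) [AddCommGroup M] [Module R M] [Module.Finite R M] (j : ℤ)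
      (hj : (e : ℤ) - d < j) := ContravariantDeltaFunctor.vanishesAt_of_lt hD.finite_ofDerived
        (p := p) (fun j hj ↦ h1 j hj.ne') M j hj
  refine ⟨fun j hj ↦ (h3 R j hj).of_equiv (ofDerivedRingEquiv D j), fun h ↦ h2 ?_⟩
  obtain ⟨ι, hι⟩ := exists_injective_of_mem_associatedPrimes hp
  exact ContravariantDeltaFunctor.vanishesAt_left (LinearMap.exact_map_mkQ_range ι) hι
    (Submodule.mkQ_surjective _) (h.of_equiv (ofDerivedRingEquiv D _).symm)
    (h3 _ _ (by omega))

end IsNormalizedDualizingComplex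

/-- If `(R, 𝔪, k)` is a commutative noetherian local ring with a
normalized dualizing complex `D` and `p` is an associated prime of `R`, then
`Ext^i_R(D, R) ≠ 0` for `i = dim (R/p) - depth R`. -/
theorem ext_dualizing_ne_zero_of_associatedPrime
    (R : Type) [CommRing R] [IsNoetherianRing R] [IsLocalRing R]
    (D : Cx R) (hD : IsNormalizedDualizingComplex R D)
    (p : Ideal R) (hp : p ∈ associatedPrimes R R)
    (d e : ℕ) (hd : (d : WithBot ℕ∞) = ringKrullDim (R ⧸ p))
    (he : (e : ℕ∞) = ringDepth R) :
    ¬ ExtVanishes D (sgl (ModuleCat.of R R)) ((d : ℤ) - (e : ℤ)) := by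
  obtain ⟨F, π, hπ⟩ := exists_isSemiprojResolution D 0 hD.vanish_neg
  have ⟨hF, ⟨b, hb⟩, _⟩ := hπ
  have : p.IsPrime := IsAssociatedPrime.isPrime hp
  have (i : ℤ) : Module.Projective R (F.X i) := (IsProjective.iff_projective _).2 (hF i)
  let φ (i : ℤ) : D.homology i ≃ₗ[R] F.homology i := (isoOfQuasiIsoAt π i).symm.toLinearEquiv
  obtain ⟨h1, h2⟩ := hD.locallyZero_homology he p hp hd
  obtain ⟨ι, hι⟩ := exists_injective_of_mem_associatedPrimes hp
  obtain ⟨f, hf, z, hz, hfz⟩ := exists_cocycle hb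
    (fun i ↦ have := hD.finite_homology i; Module.Finite.equiv (φ i))
    (fun i hi ↦ (h1 i hi).of_equiv (φ i)) (fun h ↦ h2 (h.of_equiv (φ _).symm)) ι hι
  exact not_extVanishes_of_functional hπ (by ring) f hf z hz hfz
end
end

section
/- Let (R,m,k) be a commutative noetherian local ring admitting a dualizing complex D^R, normalized so that H_i(D^R) = 0 for i < 0 and H_0(D^R) ≠ 0. If Ext^i_R(D^R, R) = 0 for all i with 1 ≤ i ≤ dim R, then R is Cohen-Macaulay. -/
open CategoryTheory CategoryTheory.Limits CochainComplex.HomComplex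

noncomputable section

/-- `M` is `U`-torsion: each of its elements is annihilated by an element of `U`. -/
def IsTors {R : Type} [CommRing R] (U : Submonoid R) (M : Type) [AddCommGroup M] [Module R M] :
    Prop :=
  ∀ m : M, ∃ u ∈ U, u • m = 0

namespace IsTors

variable {R : Type} [CommRing R] {U V : Submonoid R} {A B C : Type}
  [AddCommGroup A] [Module R A] [AddCommGroup B] [Module R B] [AddCommGroup C] [Module R C]

lemma of_subsingleton [Subsingleton A] : IsTors U A :=
  fun _ => ⟨1, U.one_mem, Subsingleton.elim _ _⟩

lemma subsingleton (h : IsTors (⊥ : Submonoid R) A) : Subsingleton A := by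
  refine subsingleton_of_forall_eq 0 fun m => ?_
  obtain ⟨u, hu, hm⟩ := h m
  rw [Submonoid.mem_bot] at hu
  simpa [hu] using hm

lemma of_forall_smul {r : R} (hr : r ∈ U) (h : ∀ m : A, r • m = 0) : IsTors U A :=
  fun m => ⟨r, hr, h m⟩

lemma of_exact {f : A →ₗ[R] B} {g : B →ₗ[R] C} (h : Function.Exact f g)
    (hA : IsTors U A) (hC : IsTors U C) : IsTors U B := by
  intro b
  obtain ⟨u, hu, hub⟩ := hC (g b)
  rw [← map_smul] at hub
  obtain ⟨c, hc⟩ := (h _).1 hub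
  obtain ⟨v, hv, hvc⟩ := hA c
  refine ⟨v * u, U.mul_mem hv hu, ?_⟩
  rw [mul_smul, ← hc, ← map_smul, hvc, map_zero]

lemma of_injective {f : A →ₗ[R] B} (hf : Function.Injective f) (hB : IsTors U B) :
    IsTors U A := by
  intro a
  obtain ⟨u, hu, hua⟩ := hB (f a)
  exact ⟨u, hu, hf (by rw [map_smul, hua, map_zero])⟩

lemma exists_forall_smul_mem [Module.Finite R A] (N : Submodule R A)
    (h : ∀ a : A, ∃ u ∈ U, u • a ∈ N) : ∃ u ∈ U, ∀ a : A, u • a ∈ N := by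
  obtain ⟨S, hS⟩ := (Module.Finite.fg_top : (⊤ : Submodule R A).FG)
  choose u hu hua using h
  refine ⟨∏ s ∈ S, u s, U.prod_mem fun s _ => hu s, fun a => ?_⟩
  have ha : a ∈ Submodule.span R (S : Set A) := hS ▸ Submodule.mem_top
  induction ha using Submodule.span_induction with
  | mem x hx =>
    obtain ⟨c, hc⟩ := Finset.dvd_prod_of_mem u hx
    rw [hc, mul_comm, mul_smul]
    exact N.smul_mem _ (hua x)
  | zero => simp
  | add x y _ _ hx hy => rw [smul_add]; exact N.add_mem hx hy
  | smul r x _ hx => rw [smul_comm]; exact N.smul_mem _ hx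

lemma exists_forall_smul_eq_zero [Module.Finite R A] (h : IsTors U A) :
    ∃ u ∈ U, ∀ a : A, u • a = 0 := by
  simpa using exists_forall_smul_mem (U := U) (⊥ : Submodule R A) h

end IsTors

/-- If `u • M ⊆ q • M` for a finitely generated module `M` and an element `u` outside the prime
ideal `q`, then `M` is annihilated by an element outside `q`. -/
lemma exists_notMem_forall_smul_eq_zero {R : Type} [CommRing R] {M : Type} [AddCommGroup M]
    [Module R M] [Module.Finite R M] (q : Ideal R) [q.IsPrime] {u : R} (hu : u ∉ q)
    (h : ∀ m : M, u • m ∈ q • (⊤ : Submodule R M)) : ∃ v, v ∉ q ∧ ∀ m : M, v • m = 0 := by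
  obtain ⟨P, hP, -, hc, h0⟩ :=
    LinearMap.exists_monic_and_natDegree_eq_and_coeff_mem_pow_and_aeval_eq_zero R
      (u • LinearMap.id : M →ₗ[R] M) q (by rintro _ ⟨m, rfl⟩; exact h m)
  refine ⟨P.eval u, fun hmem => hu ?_, fun m => ?_⟩
  · rw [Polynomial.eval_eq_sum_range, Finset.sum_range_succ, hP.coeff_natDegree, one_mul] at hmem
    refine Ideal.IsPrime.mem_of_pow_mem ‹_› P.natDegree ((Ideal.add_mem_iff_right _ ?_).1 hmem)
    refine Ideal.sum_mem _ fun k hk => Ideal.mul_mem_right _ _ ?_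
    exact Ideal.pow_le_self (by simp at hk; omega) (hc k)
  · have h1 : (u • LinearMap.id : M →ₗ[R] M) = algebraMap R (Module.End R M) u := by
      ext; simp [Module.algebraMap_end_apply]
    rw [h1, Polynomial.aeval_algebraMap_apply] at h0
    simpa using LinearMap.congr_fun h0 m

/-- A contravariant linear cohomological functor on modules. -/
structure DeltaFunctor (R : Type) [CommRing R] where
  /-- the value in a given degree -/
  obj : ℤ → (N : Type) → [AddCommGroup N] → [Module R N] → ModuleCat.{0} R
  /-- functoriality -/
  map (i : ℤ) {A B : Type} [AddCommGroup A] [Module R A] [AddCommGroup B] [Module R B] :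
    (A →ₗ[R] B) →ₗ[R] (obj i B →ₗ[R] obj i A)
  map_id (i : ℤ) (A : Type) [AddCommGroup A] [Module R A] :
    map i (LinearMap.id : A →ₗ[R] A) = LinearMap.id
  map_comp (i : ℤ) {A B C : Type} [AddCommGroup A] [Module R A] [AddCommGroup B] [Module R B]
    [AddCommGroup C] [Module R C] (f : A →ₗ[R] B) (g : B →ₗ[R] C) :
    map i (g ∘ₗ f) = map i f ∘ₗ map i g
  exact (i : ℤ) {A B C : Type} [AddCommGroup A] [Module R A] [AddCommGroup B] [Module R B]
    [AddCommGroup C] [Module R C] (f : A →ₗ[R] B) (g : B →ₗ[R] C)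
    (hf : Function.Injective f) (hg : Function.Surjective g) (hfg : Function.Exact f g) :
    Function.Exact (map i g) (map i f)
  exists_connecting (i j : ℤ) (hij : i + 1 = j) {A B C : Type} [AddCommGroup A] [Module R A]
    [AddCommGroup B] [Module R B] [AddCommGroup C] [Module R C] (f : A →ₗ[R] B) (g : B →ₗ[R] C)
    (hf : Function.Injective f) (hg : Function.Surjective g) (hfg : Function.Exact f g) :
    ∃ δ : obj i A →ₗ[R] obj j C, Function.Exact (map i f) δ ∧ Function.Exact δ (map j g)

namespace DeltaFunctor

variable {R : Type} [CommRing R] (T : DeltaFunctor R)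
  {A B C : Type} [AddCommGroup A] [Module R A] [AddCommGroup B] [Module R B]
  [AddCommGroup C] [Module R C]

lemma map_smul_id (i : ℤ) (r : R) (x : T.obj i A) :
    T.map i (r • (LinearMap.id : A →ₗ[R] A)) x = r • x := by
  rw [map_smul, T.map_id]; rfl

/-- Isomorphic modules have isomorphic values. -/
def mapEquiv (i : ℤ) (e : A ≃ₗ[R] B) : T.obj i B ≃ₗ[R] T.obj i A :=
  LinearEquiv.ofLinearMap (T.map i e.toLinearMap) (T.map i e.symm.toLinearMap)
    (by rw [← T.map_comp, LinearEquiv.symm_comp, T.map_id])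
    (by rw [← T.map_comp, LinearEquiv.comp_symm, T.map_id])

lemma smul_eq_zero_of_forall_smul (i : ℤ) {r : R} (h : ∀ a : A, r • a = 0) (x : T.obj i A) :
    r • x = 0 := by
  rw [← T.map_smul_id, show r • (LinearMap.id : A →ₗ[R] A) = 0 from LinearMap.ext h, map_zero]
  rfl

lemma subsingleton_of_subsingleton (i : ℤ) [Subsingleton A] : Subsingleton (T.obj i A) := by
  refine subsingleton_of_forall_eq 0 fun x => ?_
  simpa using T.smul_eq_zero_of_forall_smul i (r := 1) (fun a : A => Subsingleton.elim _ _) x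

/-- The filtration principle for torsion. -/
lemma isTors_of_forall_prime [IsNoetherianRing R] (U : Submonoid R) (I : Ideal R) (i : ℤ)
    (h : ∀ q : Ideal R, q.IsPrime → I ≤ q → IsTors U (T.obj i (R ⧸ q)))
    (N : Type) [AddCommGroup N] [Module R N] [hN : Module.Finite R N]
    (hI : ∀ r ∈ I, ∀ x : N, r • x = 0) : IsTors U (T.obj i N) := by
  induction hN using IsNoetherianRing.induction_on_isQuotientEquivQuotientPrime R with
  | subsingleton N =>
    have := T.subsingleton_of_subsingleton (A := N) i
    exact .of_subsingleton
  | quotient N p e =>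
    refine IsTors.of_injective (T.mapEquiv i e).symm.injective (h p.1 p.2 fun r hr => ?_)
    rw [← Ideal.Quotient.eq_zero_iff_mem]
    have := congrArg e (hI r hr (e.symm 1))
    rw [map_smul, LinearEquiv.apply_symm_apply, map_zero, Algebra.smul_def, mul_one] at this
    exact this
  | exact N₁ N₂ N₃ f g hf hg hfg h₁ h₃ =>
    refine IsTors.of_exact (T.exact i f g hf hg hfg) (h₃ fun r hr x => ?_) (h₁ fun r hr x => ?_)
    · obtain ⟨y, rfl⟩ := hg x
      rw [← map_smul, hI r hr, map_zero]
    · exact hf (by rw [map_smul, hI r hr, map_zero])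

lemma subsingleton_of_forall_prime [IsNoetherianRing R] (I : Ideal R) (i : ℤ)
    (h : ∀ q : Ideal R, q.IsPrime → I ≤ q → Subsingleton (T.obj i (R ⧸ q)))
    (N : Type) [AddCommGroup N] [Module R N] [hN : Module.Finite R N]
    (hI : ∀ r ∈ I, ∀ x : N, r • x = 0) : Subsingleton (T.obj i N) :=
  (T.isTors_of_forall_prime ⊥ I i (fun q hq hIq => by
    have := h q hq hIq
    exact .of_subsingleton) N hI).subsingleton

lemma eq_sum_map_proj (i : ℤ) (m : ℕ) (x : T.obj i (Fin m → R)) :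
    x = ∑ j, T.map i (LinearMap.proj j : (Fin m → R) →ₗ[R] R)
      (T.map i (LinearMap.single R (fun _ : Fin m => R) j) x) := by
  have h : (LinearMap.id : (Fin m → R) →ₗ[R] (Fin m → R)) =
      ∑ j, LinearMap.single R (fun _ : Fin m => R) j ∘ₗ LinearMap.proj j := by
    ext a b
    simp [Finset.sum_apply, Pi.single_apply]
  conv_lhs => rw [← LinearMap.id_apply (R := R) x, ← T.map_id, h, map_sum]
  simp [T.map_comp]

lemma finite_obj_pi (i : ℤ) [Module.Finite R (T.obj i R)] (m : ℕ) :
    Module.Finite R (T.obj i (Fin m → R)) := by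
  refine Module.Finite.of_surjective
    (∑ j, (T.map i (LinearMap.proj j : (Fin m → R) →ₗ[R] R)) ∘ₗ LinearMap.proj j :
      (Fin m → T.obj i R) →ₗ[R] T.obj i (Fin m → R)) fun x => ?_
  refine ⟨fun j => T.map i (LinearMap.single R (fun _ : Fin m => R) j) x, ?_⟩
  conv_rhs => rw [T.eq_sum_map_proj i m x]
  simp

lemma smul_obj_pi_eq_zero (i : ℤ) {r : R} (h : ∀ y : T.obj i R, r • y = 0) (m : ℕ)
    (x : T.obj i (Fin m → R)) : r • x = 0 := by
  rw [T.eq_sum_map_proj i m x, Finset.smul_sum]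
  simp only [← map_smul, h, map_zero, Finset.sum_const_zero]

lemma exists_presentation [IsNoetherianRing R] (N : Type) [AddCommGroup N] [Module R N]
    [Module.Finite R N] (i : ℤ) :
    ∃ (m : ℕ) (K : Submodule R (Fin m → R)) (g : (Fin m → R) →ₗ[R] N)
      (δ : T.obj (i - 1) K →ₗ[R] T.obj i N), Function.Exact δ (T.map i g) := by
  obtain ⟨m, g, hg⟩ := Module.Finite.exists_fin' R N
  obtain ⟨δ, -, h⟩ := T.exists_connecting (i - 1) i (by ring) (LinearMap.ker g).subtype g
    (Submodule.injective_subtype _) hg (LinearMap.exact_subtype_ker_map g)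
  exact ⟨m, _, g, δ, h⟩

section bounded

variable [IsNoetherianRing R] (a : ℤ)
  (hlow : ∀ i < a, ∀ (N : Type) [AddCommGroup N] [Module R N], Subsingleton (T.obj i N))
include hlow

lemma finite_obj (hfin : ∀ i, Module.Finite R (T.obj i R)) (i : ℤ) (N : Type) [AddCommGroup N]
    [Module R N] [Module.Finite R N] : Module.Finite R (T.obj i N) := by
  suffices h : ∀ k : ℕ, ∀ i < a + k, ∀ (N : Type) [AddCommGroup N] [Module R N]
      [Module.Finite R N], Module.Finite R (T.obj i N) from
    h (i + 1 - a).toNat i (by omega) N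
  intro k
  induction k with
  | zero =>
    intro i hi N _ _ _
    have := hlow i (by simpa using hi) N
    infer_instance
  | succ k ih =>
    intro i hi N _ _ _
    obtain ⟨m, K, g, δ, h⟩ := T.exists_presentation N i
    have := ih (i - 1) (by push_cast at hi; omega) K
    have := T.finite_obj_pi i m
    have := isNoetherian_of_range_eq_ker δ (T.map i g) (LinearMap.exact_iff.1 h).symm
    infer_instance

lemma pow_smul_eq_zero {r : R} (hr : ∀ i, ∀ x : T.obj i R, r • x = 0) (k : ℕ) (i : ℤ)
    (hi : i < a + k) (N : Type) [AddCommGroup N] [Module R N] [Module.Finite R N]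
    (x : T.obj i N) : r ^ k • x = 0 := by
  induction k generalizing i N with
  | zero =>
    have := hlow i (by simpa using hi) N
    exact Subsingleton.elim _ _
  | succ k ih =>
    obtain ⟨m, K, g, δ, h⟩ := T.exists_presentation N i
    have hx : T.map i g (r • x) = 0 := by
      rw [map_smul]; exact T.smul_obj_pi_eq_zero i (hr i) m _
    obtain ⟨y, hy⟩ := (h _).1 hx
    rw [pow_succ, mul_smul, ← hy, ← map_smul, ih (i - 1) (by push_cast at hi; omega) K y, map_zero]

end bounded

end DeltaFunctor

namespace DeltaFunctor

variable {R : Type} [CommRing R] (T : DeltaFunctor R)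

/-- The connecting map for multiplication by an injective scalar. -/
lemma exists_connecting_smul (i j : ℤ) (hij : i + 1 = j) {A C : Type} [AddCommGroup A]
    [Module R A] [AddCommGroup C] [Module R C] (x : R) (hx : IsSMulRegular A x) (g : A →ₗ[R] C)
    (hg : Function.Surjective g) (hfg : ∀ a, g a = 0 ↔ ∃ b, x • b = a) :
    ∃ δ : T.obj i A →ₗ[R] T.obj j C,
      (∀ y, δ y = 0 ↔ ∃ z, x • z = y) ∧ Function.Exact δ (T.map j g) := by
  obtain ⟨δ, h₁, h₂⟩ := T.exists_connecting i j hij (x • (LinearMap.id : A →ₗ[R] A)) g hx hg hfg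
  refine ⟨δ, fun y => (h₁ y).trans ?_, h₂⟩
  simp only [Set.mem_range, T.map_smul_id]

section finite

variable (hft : ∀ i (N : Type) [AddCommGroup N] [Module R N]
  [Module.Finite R N], Module.Finite R (T.obj i N))
include hft

lemma exists_notMem_smul_eq_zero (p q : Ideal R) [p.IsPrime] [q.IsPrime] {x : R} (hxq : x ∈ q)
    (hxp : x ∉ p) (i : ℤ)
    (h : IsTors q.primeCompl (T.obj (i + 1) (R ⧸ (p ⊔ Ideal.span {x})))) :
    ∃ v, v ∉ q ∧ ∀ y : T.obj i (R ⧸ p), v • y = 0 := by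
  have hx : IsSMulRegular (R ⧸ p) x := by
    rw [isSMulRegular_iff_right_eq_zero_of_smul]
    intro y hy
    rw [Algebra.smul_def, mul_eq_zero] at hy
    exact hy.resolve_left fun h => hxp (Ideal.Quotient.eq_zero_iff_mem.1 h)
  let g : (R ⧸ p) →ₗ[R] (R ⧸ (p ⊔ Ideal.span {x})) := Submodule.mapQ _ _ LinearMap.id le_sup_left
  have hg : Function.Surjective g := by
    intro y
    obtain ⟨y, rfl⟩ := Submodule.Quotient.mk_surjective _ y
    exact ⟨Submodule.Quotient.mk y, rfl⟩
  have hgx (y : R ⧸ p) : g y = 0 ↔ ∃ b, x • b = y := by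
    obtain ⟨y, rfl⟩ := Submodule.Quotient.mk_surjective _ y
    have : g (Submodule.Quotient.mk y) = 0 ↔ y ∈ p ⊔ Ideal.span {x} :=
      Submodule.Quotient.mk_eq_zero _
    rw [this, Submodule.mem_sup]
    constructor
    · rintro ⟨a, ha, b, hb, rfl⟩
      obtain ⟨c, rfl⟩ := Ideal.mem_span_singleton'.1 hb
      refine ⟨Submodule.Quotient.mk c, ?_⟩
      rw [← Submodule.Quotient.mk_smul, Submodule.Quotient.eq]
      simpa [mul_comm c x] using ha
    · rintro ⟨b, hb⟩
      obtain ⟨b, rfl⟩ := Submodule.Quotient.mk_surjective _ b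
      rw [← Submodule.Quotient.mk_smul, Submodule.Quotient.eq] at hb
      exact ⟨y - x * b, by simpa using p.neg_mem hb, x * b, Ideal.mem_span_singleton.2 ⟨b, rfl⟩,
        by ring⟩
  obtain ⟨δ, hδ, -⟩ := T.exists_connecting_smul i (i + 1) rfl x hx g hg hgx
  have := hft i (R ⧸ p)
  obtain ⟨u, hu, hu'⟩ := IsTors.exists_forall_smul_mem (U := q.primeCompl)
    (q • (⊤ : Submodule R (T.obj i (R ⧸ p)))) fun y => by
      obtain ⟨u, hu, huy⟩ := h (δ y)
      rw [← map_smul, hδ] at huy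
      obtain ⟨z, hz⟩ := huy
      exact ⟨u, hu, hz ▸ Submodule.smul_mem_smul hxq Submodule.mem_top⟩
  exact exists_notMem_forall_smul_eq_zero q hu hu'

variable [IsNoetherianRing R]

lemma not_isTors_of_covBy (p q : PrimeSpectrum R) (hpq : p ⋖ q) (i : ℤ)
    (h : ¬ IsTors p.asIdeal.primeCompl (T.obj i (R ⧸ p.asIdeal))) :
    ¬ IsTors q.asIdeal.primeCompl (T.obj (i + 1) (R ⧸ q.asIdeal)) := by
  intro hq
  obtain ⟨x, hxq, hxp⟩ := SetLike.exists_of_lt (PrimeSpectrum.asIdeal_lt_asIdeal _ _ |>.2 hpq.lt)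
  have htors : IsTors q.asIdeal.primeCompl
      (T.obj (i + 1) (R ⧸ (p.asIdeal ⊔ Ideal.span {x}))) := by
    refine T.isTors_of_forall_prime _ (p.asIdeal ⊔ Ideal.span {x}) _ (fun q' hq' hle => ?_) _ ?_
    · by_cases hle' : q' ≤ q.asIdeal
      · have hlt : p < (⟨q', hq'⟩ : PrimeSpectrum R) := by
          refine lt_of_le_of_ne (le_sup_left.trans hle) fun he => hxp ?_
          rw [he]
          exact hle (Ideal.mem_sup_right (Ideal.mem_span_singleton_self x))
        have hq'q : (⟨q', hq'⟩ : PrimeSpectrum R) = q :=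
          PrimeSpectrum.ext ((lt_or_eq_of_le hle').resolve_left fun hlt' => hpq.2 hlt hlt')
        subst hq'q
        exact hq
      · obtain ⟨r, hr, hrq⟩ := SetLike.not_le_iff_exists.1 hle'
        refine .of_forall_smul (r := r) hrq (T.smul_eq_zero_of_forall_smul _ fun a => ?_)
        rw [Algebra.smul_def, Ideal.Quotient.algebraMap_eq, Ideal.Quotient.eq_zero_iff_mem.2 hr,
          zero_mul]
    · intro r hr a
      rw [Algebra.smul_def, Ideal.Quotient.algebraMap_eq, Ideal.Quotient.eq_zero_iff_mem.2 hr,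
        zero_mul]
  obtain ⟨v, hv, hv'⟩ := T.exists_notMem_smul_eq_zero hft p.asIdeal q.asIdeal hxq hxp i htors
  exact h (.of_forall_smul (r := v) (fun hvp => hv (hpq.le hvp)) hv')

variable [IsLocalRing R] (n : ℤ)
  (hk : ∀ i, i ≠ n → Subsingleton (T.obj i (R ⧸ IsLocalRing.maximalIdeal R)))
include hk

lemma exists_ltSeries_of_nontrivial (q : PrimeSpectrum R) (i : ℤ)
    (h : Nontrivial (T.obj i (R ⧸ q.asIdeal))) :
    i ≤ n ∧ ∃ s : LTSeries (PrimeSpectrum R), s.head = q ∧ n - i ≤ s.length := by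
  have : WellFoundedGT (PrimeSpectrum R) :=
    StrictMono.wellFoundedGT (f := PrimeSpectrum.asIdeal) fun _ _ h => h
  induction q using WellFoundedGT.induction generalizing i with
  | ind q ih =>
  by_cases hq : q = IsLocalRing.closedPoint R
  · subst hq
    have : i = n := by
      by_contra hne
      exact not_subsingleton_iff_nontrivial.2 h (hk i hne)
    subst this
    exact ⟨le_rfl, RelSeries.singleton _ _, rfl, by simp⟩
  · have hlt : q.asIdeal < IsLocalRing.maximalIdeal R :=
      lt_of_le_of_ne (IsLocalRing.le_maximalIdeal q.2.ne_top)
        fun he => hq (PrimeSpectrum.ext he)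
    obtain ⟨x, hxm, hxq⟩ := SetLike.exists_of_lt hlt
    obtain ⟨q', hq', hlt', hnt⟩ : ∃ q' : Ideal R, ∃ _ : q'.IsPrime,
        q.asIdeal ⊔ Ideal.span {x} ≤ q' ∧ Nontrivial (T.obj (i + 1) (R ⧸ q')) := by
      by_contra! hcon
      have hs : Subsingleton (T.obj (i + 1) (R ⧸ (q.asIdeal ⊔ Ideal.span {x}))) := by
        refine T.subsingleton_of_forall_prime (q.asIdeal ⊔ Ideal.span {x}) _
          (fun q' hq' hle => hcon q' hq' hle) _ fun r hr a => ?_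
        rw [Algebra.smul_def, Ideal.Quotient.algebraMap_eq, Ideal.Quotient.eq_zero_iff_mem.2 hr,
          zero_mul]
      obtain ⟨v, hv, hv'⟩ := T.exists_notMem_smul_eq_zero hft q.asIdeal
        (IsLocalRing.maximalIdeal R) hxm hxq i .of_subsingleton
      obtain ⟨y, hy⟩ := exists_ne (0 : T.obj i (R ⧸ q.asIdeal))
      have hu : IsUnit v := by simpa using hv
      exact hy ((hu.smul_eq_zero).1 (hv' y))
    have hqq' : q < (⟨q', hq'⟩ : PrimeSpectrum R) := by
      refine lt_of_le_of_ne (le_sup_left.trans hlt') fun he => hxq ?_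
      rw [he]
      exact hlt' (Ideal.mem_sup_right (Ideal.mem_span_singleton_self x))
    obtain ⟨h₁, s, hs, hs'⟩ := ih ⟨q', hq'⟩ hqq' (i + 1) hnt
    refine ⟨by omega, s.cons q (by rw [hs]; exact hqq'), by simp, ?_⟩
    simp only [RelSeries.cons_length]
    push_cast
    omega

lemma subsingleton_of_lt (i : ℤ) (hi : n < i) (N : Type) [AddCommGroup N] [Module R N]
    [Module.Finite R N] : Subsingleton (T.obj i N) := by
  refine T.subsingleton_of_forall_prime ⊥ i (fun q hq _ => ?_) N (by simp)
  by_contra h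
  have := (T.exists_ltSeries_of_nontrivial hft n hk ⟨q, hq⟩ i
    (not_subsingleton_iff_nontrivial.1 h)).1
  omega

lemma sub_le_of_nontrivial (i : ℤ) (e : ℕ) (he : ringKrullDim R = e)
    (h : Nontrivial (T.obj i R)) : i ≤ n ∧ n - i ≤ e := by
  obtain ⟨q, hq, hnt⟩ : ∃ q : Ideal R, ∃ _ : q.IsPrime, Nontrivial (T.obj i (R ⧸ q)) := by
    by_contra! hcon
    exact not_subsingleton_iff_nontrivial.2 h
      (T.subsingleton_of_forall_prime ⊥ i (fun q hq _ => hcon q hq) R (by simp))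
  obtain ⟨h₁, s, -, hs⟩ := T.exists_ltSeries_of_nontrivial hft n hk ⟨q, hq⟩ i hnt
  have : (s.length : WithBot ℕ∞) ≤ e := he ▸ Order.LTSeries.length_le_krullDim s
  have : s.length ≤ e := by exact_mod_cast this
  omega

lemma not_isTors_closedPoint (s : LTSeries (PrimeSpectrum R)) (e : ℕ) (he : s.length = e)
    (hs : ∀ t : LTSeries (PrimeSpectrum R), t.length ≤ e) (i : ℤ)
    (h : ¬ IsTors s.head.asIdeal.primeCompl (T.obj i (R ⧸ s.head.asIdeal))) : i + e = n := by
  have key : ∀ (j : Fin (s.length + 1)) (l : ℤ), l = i + (j : ℕ) →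
      ¬ IsTors (s j).asIdeal.primeCompl (T.obj l (R ⧸ (s j).asIdeal)) := by
    intro j
    induction j using Fin.induction with
    | zero =>
      intro l hl
      obtain rfl : l = i := by simpa using hl
      exact h
    | succ j ih =>
      intro l hl
      have hc : s j.castSucc ⋖ s j.succ := by
        refine ⟨s.step j, fun c h₁ h₂ => ?_⟩
        have := hs (s.insertNth j c h₁ h₂)
        simp at this
        omega
      obtain rfl : l = i + (j : ℕ) + 1 := by simpa [add_assoc] using hl
      exact T.not_isTors_of_covBy hft _ _ hc _ (ih _ rfl)
  have hlast : s.last = IsLocalRing.closedPoint R := by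
    by_contra hne
    have hlt : s.last < IsLocalRing.closedPoint R := lt_of_le_of_ne (by
      exact IsLocalRing.le_maximalIdeal s.last.2.ne_top) hne
    have := hs (s.snoc _ hlt)
    simp at this
    omega
  have h₂ := key (Fin.last _) (i + e) (by simp [he])
  change ¬ IsTors s.last.asIdeal.primeCompl (T.obj _ (R ⧸ s.last.asIdeal)) at h₂
  rw [hlast] at h₂
  by_contra hne
  have : Subsingleton (T.obj (i + e) (R ⧸ (IsLocalRing.closedPoint R).asIdeal)) := hk _ hne
  exact h₂ .of_subsingleton

end finite

end DeltaFunctor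

namespace DeltaFunctor

variable {R : Type} [CommRing R] (T : DeltaFunctor R) [IsNoetherianRing R] [IsLocalRing R]
  (hft : ∀ i (N : Type) [AddCommGroup N] [Module R N] [Module.Finite R N],
    Module.Finite R (T.obj i N))
  (n : ℤ) (hk : ∀ i, i ≠ n → Subsingleton (T.obj i (R ⧸ IsLocalRing.maximalIdeal R)))

lemma subsingleton_of_pow_smul (hk : ∀ i, i ≠ n →
      Subsingleton (T.obj i (R ⧸ IsLocalRing.maximalIdeal R))) (i : ℤ) (hi : i ≠ n)
    (j : ℕ) (N : Type) [AddCommGroup N] [Module R N] [Module.Finite R N]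
    (hN : ∀ r ∈ IsLocalRing.maximalIdeal R ^ j, ∀ x : N, r • x = 0) :
    Subsingleton (T.obj i N) := by
  refine T.subsingleton_of_forall_prime _ i (fun q hq hle => ?_) N hN
  have : q = IsLocalRing.maximalIdeal R := le_antisymm (IsLocalRing.le_maximalIdeal hq.ne_top)
    (hq.le_of_pow_le hle)
  subst this
  exact hk i hi

include hft hk

lemma map_surjective_of_injective {A B : Type} [AddCommGroup A] [Module R A] [AddCommGroup B]
    [Module R B] [Module.Finite R B] (f : A →ₗ[R] B) (hf : Function.Injective f) :
    Function.Surjective (T.map n f) := by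
  obtain ⟨δ, h, -⟩ := T.exists_connecting n (n + 1) rfl f (LinearMap.range f).mkQ hf
    (Submodule.mkQ_surjective _) (LinearMap.exact_map_mkQ_range f)
  have := T.subsingleton_of_lt hft n hk (n + 1) (by omega) (B ⧸ LinearMap.range f)
  exact fun x => (h x).1 (Subsingleton.elim _ _)

variable (hkn : Nontrivial (T.obj n (R ⧸ IsLocalRing.maximalIdeal R)))
include hkn

lemma nontrivial_of_injective {B : Type} [AddCommGroup B] [Module R B] [Module.Finite R B]
    (f : (R ⧸ IsLocalRing.maximalIdeal R) →ₗ[R] B) (hf : Function.Injective f) :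
    Nontrivial (T.obj n B) :=
  (T.map_surjective_of_injective hft n hk f hf).nontrivial

lemma nontrivial_of_pow_smul (j : ℕ) (N : Type) [AddCommGroup N] [Module R N]
    [Module.Finite R N] [Nontrivial N]
    (hN : ∀ r ∈ IsLocalRing.maximalIdeal R ^ j, ∀ x : N, r • x = 0) :
    Nontrivial (T.obj n N) := by
  obtain ⟨p, hp⟩ := associatedPrimes.nonempty R N
  rw [AssociatedPrimes.mem_iff, isAssociatedPrime_iff] at hp
  obtain ⟨hp, x, hx⟩ := hp
  have hpm : p = IsLocalRing.maximalIdeal R :=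
    le_antisymm (IsLocalRing.le_maximalIdeal hp.ne_top)
      (hp.le_of_pow_le fun r hr => by rw [hx, Submodule.mem_colon_singleton]; simpa using hN r hr x)
  have hker : IsLocalRing.maximalIdeal R = LinearMap.ker (LinearMap.toSpanSingleton R N x) := by
    rw [← hpm, hx]
    ext r
    simp [Submodule.mem_colon_singleton]
  refine T.nontrivial_of_injective hft n hk hkn
    (Submodule.liftQ _ (LinearMap.toSpanSingleton R N x) hker.le) ?_
  rw [← LinearMap.ker_eq_bot]
  exact Submodule.ker_liftQ_eq_bot _ _ _ hker.ge

/-- Elements outside `𝔪 ^ j` act nontrivially on the dual of `R ⧸ 𝔪 ^ j`. -/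
lemma exists_smul_ne_zero (j : ℕ) (r : R) (hr : r ∉ IsLocalRing.maximalIdeal R ^ j) :
    ∃ y : T.obj n (R ⧸ IsLocalRing.maximalIdeal R ^ j), r • y ≠ 0 := by
  set N := R ⧸ IsLocalRing.maximalIdeal R ^ j
  have hN : ∀ r ∈ IsLocalRing.maximalIdeal R ^ j, ∀ x : N, r • x = 0 := fun r hr a => by
    rw [Algebra.smul_def, Ideal.Quotient.algebraMap_eq, Ideal.Quotient.eq_zero_iff_mem.2 hr,
      zero_mul]
  let c : N →ₗ[R] N := r • LinearMap.id
  let g := c.rangeRestrict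
  let ι := (LinearMap.range c).subtype
  have hcomp : ι ∘ₗ g = r • LinearMap.id := by ext; rfl
  have hL : Nontrivial (LinearMap.range c) := by
    refine ⟨⟨0, ⟨c 1, 1, rfl⟩, fun h => hr ?_⟩⟩
    have : c 1 = 0 := (congrArg Subtype.val h).symm
    have h1 : c 1 = Ideal.Quotient.mk _ r := by
      change r • (1 : N) = _
      rw [Algebra.smul_def, mul_one]; rfl
    rw [h1] at this
    exact Ideal.Quotient.eq_zero_iff_mem.1 this
  have := T.nontrivial_of_pow_smul hft n hk hkn j (LinearMap.range c)
    fun r hr x => Subtype.ext (hN r hr x)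
  obtain ⟨z, hz⟩ := exists_ne (0 : T.obj n (LinearMap.range c))
  obtain ⟨y, rfl⟩ := T.map_surjective_of_injective hft n hk ι (Submodule.injective_subtype _) z
  refine ⟨y, fun h0 => hz ?_⟩
  rw [← T.map_smul_id, ← hcomp, T.map_comp] at h0
  obtain ⟨δ, -, hδ⟩ := T.exists_connecting (n - 1) n (by ring) (LinearMap.ker g).subtype g
    (Submodule.injective_subtype _) c.surjective_rangeRestrict (LinearMap.exact_subtype_ker_map g)
  have := T.subsingleton_of_pow_smul n hk (n - 1) (by omega) j (LinearMap.ker g)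
    fun r hr x => Subtype.ext (hN r hr x)
  obtain ⟨w, hw⟩ := (hδ _).1 h0
  rw [← hw, Subsingleton.elim w 0, map_zero]

/-- The cohomology modules `T.obj i R` have no common annihilator which is not nilpotent. -/
lemma exists_smul_ne_zero_of_pow_ne_zero (a : ℤ)
    (hlow : ∀ i < a, ∀ (N : Type) [AddCommGroup N] [Module R N], Subsingleton (T.obj i N))
    (r : R) (hr : ∀ k : ℕ, r ^ k ≠ 0) : ∃ i, ∃ x : T.obj i R, r • x ≠ 0 := by
  by_contra! hcon
  set k := (n + 1 - a).toNat
  obtain ⟨j, hj⟩ : ∃ j, r ^ k ∉ IsLocalRing.maximalIdeal R ^ j := by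
    by_contra! h
    have h0 : r ^ k ∈ ⨅ j, IsLocalRing.maximalIdeal R ^ j := by simpa using h
    rw [Ideal.iInf_pow_eq_bot_of_isLocalRing _ Ideal.IsPrime.ne_top'] at h0
    exact hr k h0
  obtain ⟨y, hy⟩ := T.exists_smul_ne_zero hft n hk hkn j _ hj
  exact hy (T.pow_smul_eq_zero a hlow hcon k n (by omega) _ y)

/-- Localizing at the bottom of a chain of primes of maximal length leaves cohomology only in
degree `n - dim R`. -/
lemma exists_minimal_prime (a b : ℤ)
    (hlow : ∀ i < a, ∀ (N : Type) [AddCommGroup N] [Module R N], Subsingleton (T.obj i N))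
    (hhigh : ∀ i, b < i → Subsingleton (T.obj i R)) (e : ℕ) (he : ringKrullDim R = e) :
    ∃ p ∈ minimalPrimes R, ∃ _ : p.IsPrime, ¬ IsTors p.primeCompl (T.obj (n - e) R) ∧
      ∀ i, i ≠ n - e → IsTors p.primeCompl (T.obj i R) := by
  obtain ⟨s, hs⟩ : ∃ s : LTSeries (PrimeSpectrum R), s.length = e :=
    Order.le_krullDim_iff.1 he.ge
  have hmax (t : LTSeries (PrimeSpectrum R)) : t.length ≤ e := by
    have : (t.length : WithBot ℕ∞) ≤ e := he ▸ Order.LTSeries.length_le_krullDim t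
    exact_mod_cast this
  set p := s.head
  have hmin : ∀ q : PrimeSpectrum R, q ≤ p → q = p := by
    intro q hq
    by_contra hne
    have := hmax (s.cons q (lt_of_le_of_ne hq hne))
    simp at this
    omega
  have htors : ∀ i, i ≠ n - e → IsTors p.asIdeal.primeCompl (T.obj i R) := by
    intro i hi
    refine T.isTors_of_forall_prime _ ⊥ i (fun q hq _ => ?_) R (by simp)
    by_cases hle : q ≤ p.asIdeal
    · have hqp := hmin ⟨q, hq⟩ hle
      have hqp' : q = p.asIdeal := congrArg PrimeSpectrum.asIdeal hqp
      subst hqp'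
      by_contra h
      have := T.not_isTors_closedPoint hft n hk s e hs hmax i h
      omega
    · obtain ⟨r, hr, hrp⟩ := SetLike.not_le_iff_exists.1 hle
      refine .of_forall_smul (r := r) hrp (T.smul_eq_zero_of_forall_smul _ fun a => ?_)
      rw [Algebra.smul_def, Ideal.Quotient.algebraMap_eq, Ideal.Quotient.eq_zero_iff_mem.2 hr,
        zero_mul]
  refine ⟨p.asIdeal, ?_, p.2, fun hcon => ?_, htors⟩
  · rw [minimalPrimes_eq_minimals]
    exact ⟨p.2, fun q hq hle => (congrArg PrimeSpectrum.asIdeal (hmin ⟨q, hq⟩ hle)).ge⟩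
  · have hall : ∀ i, IsTors p.asIdeal.primeCompl (T.obj i R) := fun i => by
      by_cases hi : i = n - e
      · exact hi ▸ hcon
      · exact htors i hi
    have hall' : ∀ i, ∃ u ∈ p.asIdeal.primeCompl, ∀ x : T.obj i R, u • x = 0 := fun i => by
      have := hft i R
      exact (hall i).exists_forall_smul_eq_zero
    choose u hu hux using hall'
    obtain ⟨i, x, hx⟩ := T.exists_smul_ne_zero_of_pow_ne_zero hft n hk hkn a hlow
      (∏ i ∈ Finset.Icc a b, u i) fun k h0 => by
        have := p.asIdeal.primeCompl.pow_mem (p.asIdeal.primeCompl.prod_mem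
          fun i (_ : i ∈ Finset.Icc a b) => hu i) k
        rw [h0] at this
        exact this p.asIdeal.zero_mem
    by_cases hi : i ∈ Finset.Icc a b
    · obtain ⟨c, hc⟩ := Finset.dvd_prod_of_mem u hi
      rw [hc, mul_comm, mul_smul, hux, smul_zero] at hx
      exact hx rfl
    · rw [Finset.mem_Icc, not_and_or, not_le, not_le] at hi
      have : Subsingleton (T.obj i R) := hi.elim (fun h => hlow i h R) (hhigh i)
      exact hx (Subsingleton.elim _ _)

open scoped Pointwise in
/-- Vanishing of `T.obj i M` in high degrees yields long regular sequences on `M`. -/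
lemma exists_isRegular (t : ℕ) (M : Type) [AddCommGroup M] [Module R M] [Module.Finite R M]
    [Nontrivial M] (hM : ∀ i, n - t < i → Subsingleton (T.obj i M)) :
    ∃ rs : List R, rs.length = t ∧ (∀ r ∈ rs, r ∈ IsLocalRing.maximalIdeal R) ∧
      RingTheory.Sequence.IsRegular M rs := by
  induction t generalizing M with
  | zero =>
    exact ⟨[], rfl, by simp, RingTheory.Sequence.IsRegular.nil R M⟩
  | succ t ih =>
    have hsub : Subsingleton ((R ⧸ IsLocalRing.maximalIdeal R) →ₗ[R] M) := by
      refine subsingleton_of_forall_eq 0 fun f => ?_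
      by_contra hf
      have hinj : Function.Injective f := by
        have : IsSimpleModule R (R ⧸ IsLocalRing.maximalIdeal R) :=
          isSimpleModule_iff_quot_maximal.2 ⟨_, inferInstance, ⟨LinearEquiv.refl _ _⟩⟩
        exact (LinearMap.injective_or_eq_zero f).resolve_right hf
      have := T.nontrivial_of_injective hft n hk hkn f hinj
      exact not_subsingleton_iff_nontrivial.2 this (hM n (by push_cast; omega))
    obtain ⟨x, hx, hreg⟩ := IsSMulRegular.subsingleton_linearMap_iff.1 hsub
    rw [Ideal.annihilator_quotient] at hx
    have hnt : Nontrivial (QuotSMulTop x M) := by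
      refine Submodule.Quotient.nontrivial_iff.2 fun h => ?_
      have := (Submodule.eq_bot_of_le_smul_of_le_jacobson_bot (Ideal.span {x})
        (⊤ : Submodule R M) Module.Finite.fg_top (by rw [Submodule.ideal_span_singleton_smul, h]) ?_)
      · exact bot_ne_top this.symm
      · rw [IsLocalRing.jacobson_eq_maximalIdeal _ bot_ne_top]
        simpa using hx
    obtain ⟨rs, hlen, hmem, hrs⟩ := ih (QuotSMulTop x M) fun i hi => by
      obtain ⟨δ, -, h⟩ := T.exists_connecting_smul (i - 1) i (by ring) x hreg
        (x • (⊤ : Submodule R M)).mkQ (Submodule.mkQ_surjective _) fun y => by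
          simp [Submodule.mem_smul_pointwise_iff_exists]
      have := hM (i - 1) (by push_cast; omega)
      have := hM i (by push_cast; omega)
      refine subsingleton_of_forall_eq 0 fun y => ?_
      obtain ⟨w, hw⟩ := (h y).1 (Subsingleton.elim _ _)
      rw [← hw, Subsingleton.elim w 0, map_zero]
    exact ⟨x :: rs, by simp [hlen], by simpa using ⟨hx, hmem⟩, hrs.cons hreg⟩

end DeltaFunctor

section HomCx

variable {R : Type} [CommRing R]

/-- The complex of modules `Hom(N, I)`. -/
def homCx (N : Type) [AddCommGroup N] [Module R N] (I : CochainComplex (ModuleCat.{0} R) ℤ) :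
    CochainComplex (ModuleCat.{0} R) ℤ where
  X j := ModuleCat.of R (N →ₗ[R] I.X j)
  d i j := ModuleCat.ofHom (LinearMap.llcomp R N (I.X i) (I.X j) (I.d i j).hom)
  shape i j h := by
    ext f x
    simp [I.shape i j h]
  d_comp_d' i j k _ _ := by
    ext f x
    change (I.d i j ≫ I.d j k) (f x) = 0
    simp

/-- Functoriality of `homCx` in the module. -/
def homCxMap {A B : Type} [AddCommGroup A] [Module R A] [AddCommGroup B] [Module R B]
    (f : A →ₗ[R] B) (I : CochainComplex (ModuleCat.{0} R) ℤ) : homCx B I ⟶ homCx A I where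
  f j := ModuleCat.ofHom (LinearMap.lcomp R (I.X j) f)

lemma homologyMap_smul' {K L : CochainComplex (ModuleCat.{0} R) ℤ} (r : R) (φ : K ⟶ L) (i : ℤ) :
    HomologicalComplex.homologyMap (r • φ) i = r • HomologicalComplex.homologyMap φ i :=
  ShortComplex.homologyMap_smul
    ((HomologicalComplex.shortComplexFunctor (ModuleCat.{0} R) (ComplexShape.up ℤ) i).map φ) r

variable (I : CochainComplex (ModuleCat.{0} R) ℤ)

section

variable {A B C : Type} [AddCommGroup A] [Module R A] [AddCommGroup B] [Module R B]
    [AddCommGroup C] [Module R C] (f : A →ₗ[R] B) (g : B →ₗ[R] C) (hfg : Function.Exact f g)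

/-- The short complex of Hom-complexes attached to an exact sequence of modules. -/
def homCxShortComplex : ShortComplex (CochainComplex (ModuleCat.{0} R) ℤ) where
  X₁ := homCx C I
  X₂ := homCx B I
  X₃ := homCx A I
  f := homCxMap g I
  g := homCxMap f I
  zero := by
    ext j φ
    refine LinearMap.ext fun x => ?_
    change (show C →ₗ[R] I.X j from φ) (g (f x)) = 0
    rw [hfg.apply_apply_eq_zero, map_zero]

lemma homCxShortComplex_shortExact (hI : ∀ j, Injective (I.X j)) (hf : Function.Injective f)
    (hg : Function.Surjective g) : (homCxShortComplex I f g hfg).ShortExact := by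
  refine HomologicalComplex.shortExact_of_degreewise_shortExact _ fun j => ?_
  refine ModuleCat.shortComplex_shortExact _ ?_ ?_ ?_
  · intro φ
    constructor
    · intro h
      have h' : ∀ x, (show B →ₗ[R] I.X j from φ) (f x) = 0 := fun x => LinearMap.congr_fun h x
      have hker : LinearMap.ker g ≤ LinearMap.ker (φ : B →ₗ[R] I.X j) := fun b hb => by
        obtain ⟨a, rfl⟩ := (hfg b).1 hb
        exact h' a
      refine ⟨((LinearMap.ker g).liftQ (φ : B →ₗ[R] I.X j) hker) ∘ₗ
        (g.quotKerEquivOfSurjective hg).symm.toLinearMap, LinearMap.ext fun b => ?_⟩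
      change (LinearMap.ker g).liftQ (φ : B →ₗ[R] I.X j) hker
        ((g.quotKerEquivOfSurjective hg).symm (g b)) = (show B →ₗ[R] I.X j from φ) b
      have : (g.quotKerEquivOfSurjective hg).symm (g b) = Submodule.Quotient.mk b := by
        rw [LinearEquiv.symm_apply_eq]; rfl
      rw [this]
      rfl
    · rintro ⟨ψ, rfl⟩
      refine LinearMap.ext fun x => ?_
      change (show C →ₗ[R] I.X j from ψ) (g (f x)) = 0
      rw [hfg.apply_apply_eq_zero, map_zero]
  · intro φ ψ h
    refine LinearMap.ext fun c => ?_
    obtain ⟨b, rfl⟩ := hg c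
    exact LinearMap.congr_fun h b
  · intro φ
    have : Mono (ModuleCat.ofHom f) := (ModuleCat.mono_iff_injective _).2 hf
    have := hI j
    refine ⟨(Injective.factorThru (ModuleCat.ofHom (φ : A →ₗ[R] I.X j)) (ModuleCat.ofHom f)).hom,
      LinearMap.ext fun x => ?_⟩
    exact ConcreteCategory.congr_hom (Injective.comp_factorThru
      (ModuleCat.ofHom (φ : A →ₗ[R] I.X j)) (ModuleCat.ofHom f)) x

end

/-- The contravariant cohomological functor `N ↦ H^i(Hom(N, I))` for a complex of injectives. -/
def homDelta (hI : ∀ j, Injective (I.X j)) : DeltaFunctor R where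
  obj i N _ _ := (homCx N I).homology i
  map i {A B} _ _ _ _ :=
    { toFun := fun f => (HomologicalComplex.homologyMap (homCxMap f I) i).hom
      map_add' := fun f g => by
        rw [← ModuleCat.hom_add, ← HomologicalComplex.homologyMap_add]
        congr 2
        ext j φ
        exact LinearMap.ext fun x => map_add (show B →ₗ[R] I.X j from φ) _ _
      map_smul' := fun r f => by
        rw [RingHom.id_apply, ← ModuleCat.hom_smul, ← homologyMap_smul']
        congr 2
        ext j φ
        exact LinearMap.ext fun x => map_smul (show B →ₗ[R] I.X j from φ) _ _ }
  map_id i A _ _ := by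
    change (HomologicalComplex.homologyMap (𝟙 (homCx A I)) i).hom = _
    rw [HomologicalComplex.homologyMap_id]
    rfl
  map_comp i {A B C} _ _ _ _ _ _ f g := by
    change (HomologicalComplex.homologyMap (homCxMap g I ≫ homCxMap f I) i).hom = _
    rw [HomologicalComplex.homologyMap_comp]
    rfl
  exact i {A B C} _ _ _ _ _ _ f g hf hg hfg :=
    (ShortComplex.ShortExact.moduleCat_exact_iff_function_exact _).1
      ((homCxShortComplex_shortExact I f g hfg hI hf hg).homology_exact₂ i)
  exists_connecting i j hij {A B C} _ _ _ _ _ _ f g hf hg hfg := by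
    have h := homCxShortComplex_shortExact I f g hfg hI hf hg
    exact ⟨(h.δ i j hij).hom,
      (ShortComplex.ShortExact.moduleCat_exact_iff_function_exact _).1 (h.homology_exact₃ i j hij),
      (ShortComplex.ShortExact.moduleCat_exact_iff_function_exact _).1 (h.homology_exact₁ i j hij)⟩

/-- `Hom(R, I)` is isomorphic to `I`. -/
def homCxSelfIso : homCx R I ≅ I :=
  HomologicalComplex.Hom.isoOfComponents
    (fun j => (LinearMap.ringLmapEquivSelf R R (I.X j)).toModuleIso) (by
      intro i j _
      ext φ
      rfl)

lemma homCx_subsingleton_homology_iff (N : Type) [AddCommGroup N] [Module R N] (i j k : ℤ)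
    (hij : i + 1 = j) (hjk : j + 1 = k) :
    Subsingleton ((homCx N I).homology j) ↔ ∀ φ : ModuleCat.of R N ⟶ I.X j, φ ≫ I.d j k = 0 →
      ∃ ψ : ModuleCat.of R N ⟶ I.X i, ψ ≫ I.d i j = φ := by
  rw [← ModuleCat.isZero_iff_subsingleton, ← HomologicalComplex.exactAt_iff_isZero_homology,
    HomologicalComplex.exactAt_iff' _ i j k (by simp; omega) (by simp; omega),
    ShortComplex.moduleCat_exact_iff]
  constructor
  · intro h φ hφ
    obtain ⟨ψ, hψ⟩ := h (φ.hom : N →ₗ[R] I.X j) (congrArg ModuleCat.Hom.hom hφ)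
    exact ⟨ModuleCat.ofHom ψ, ModuleCat.hom_ext hψ⟩
  · intro h φ hφ
    obtain ⟨ψ, hψ⟩ := h (ModuleCat.ofHom (φ : N →ₗ[R] I.X j)) (ModuleCat.hom_ext hφ)
    exact ⟨ψ.hom, congrArg ModuleCat.Hom.hom hψ⟩

lemma homCx_subsingleton_homology_of_isZero (N : Type) [AddCommGroup N] [Module R N] (j : ℤ)
    (h : IsZero (I.X j)) : Subsingleton ((homCx N I).homology j) := by
  rw [homCx_subsingleton_homology_iff I N (j - 1) j (j + 1) (by ring) rfl]
  exact fun φ _ => ⟨0, h.eq_of_tgt _ _⟩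

end HomCx

section Bridge

variable {R : Type} [CommRing R]

lemma hasSmallLocalizedShiftedHom_one (K L : CochainComplex (ModuleCat.{0} R) ℤ) :
    Localization.HasSmallLocalizedShiftedHom.{1}
      (HomologicalComplex.quasiIso (ModuleCat.{0} R) (ComplexShape.up ℤ)) ℤ K L := by
  let := HasDerivedCategory.standard (ModuleCat.{0} R)
  rw [Localization.hasSmallLocalizedShiftedHom_iff _ _ DerivedCategory.Q]
  intro a b
  infer_instance

lemma nonempty_cohomologyClass_equiv {P K D I : CochainComplex (ModuleCat.{0} R) ℤ} (π : P ⟶ K)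
    (ι : D ⟶ I) [QuasiIso π] [QuasiIso ι] [P.IsKProjective] [I.IsKInjective] (n : ℤ) :
    Nonempty (CohomologyClass P D n ≃ CohomologyClass K I n) := by
  have := hasSmallLocalizedShiftedHom_one (R := R)
  exact ⟨CohomologyClass.equivOfIsKProjective.{1}.trans
    ((Localization.SmallShiftedHom.postcompEquiv ι ‹_›).trans
    ((Localization.SmallShiftedHom.precompEquiv π ‹_›).symm.trans
    CohomologyClass.equivOfIsKInjective.{1}.symm))⟩

lemma subsingleton_cohomologyClass_iff {K L : CochainComplex (ModuleCat.{0} R) ℤ} (n : ℤ) :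
    Subsingleton (CohomologyClass K L n) ↔ ∀ f : Cochain K L n, δ n (n + 1) f = 0 →
      ∃ g : Cochain K L (n - 1), δ (n - 1) n g = f := by
  constructor
  · intro h f hf
    have := (CohomologyClass.mk_eq_zero_iff (Cocycle.mk f (n + 1) rfl hf)).1 (h.elim _ _)
    rwa [mem_coboundaries_iff _ (n - 1) (by simp)] at this
  · intro h
    refine subsingleton_of_forall_eq 0 fun x => ?_
    obtain ⟨x, rfl⟩ := x.mk_surjective
    rw [CohomologyClass.mk_eq_zero_iff, mem_coboundaries_iff _ (n - 1) (by simp)]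
    exact h x.1 (x.δ_eq_zero _)

lemma subsingleton_cohomologyClass_single_iff (N : Type) [AddCommGroup N] [Module R N]
    (I : CochainComplex (ModuleCat.{0} R) ℤ) (n : ℤ) :
    Subsingleton (CohomologyClass
        ((CochainComplex.singleFunctor (ModuleCat.{0} R) 0).obj (ModuleCat.of R N)) I n) ↔
      Subsingleton ((homCx N I).homology n) := by
  rw [homCx_subsingleton_homology_iff I N (n - 1) n (n + 1) (by ring) rfl]
  constructor
  · intro h φ hφ
    rw [← Cocycle.fromSingleMk_mem_coboundaries_iff φ (p := 0) (zero_add n) (n + 1) rfl hφ (n - 1)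
      (by ring), ← CohomologyClass.mk_eq_zero_iff]
    exact h.elim _ _
  · intro h
    refine subsingleton_of_forall_eq 0 fun x => ?_
    obtain ⟨x, rfl⟩ := x.mk_surjective
    obtain ⟨φ, hφ, rfl⟩ := Cocycle.fromSingleMk_surjective (p := 0) x n (zero_add n) (n + 1) rfl
    rw [CohomologyClass.mk_eq_zero_iff]
    exact (Cocycle.fromSingleMk_mem_coboundaries_iff φ (p := 0) (zero_add n) (n + 1) rfl hφ (n - 1)
      (by ring)).2 (h φ hφ)

lemma subsingleton_extModule_iff (F N : Cx R) (n : ℤ) :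
    Subsingleton (extModule R F N n) ↔ ∀ f : Cochain F N n, δ n (n + 1) f = 0 →
      ∃ g : Cochain F N (n - 1), δ (n - 1) n g = f := by
  rw [Submodule.Quotient.subsingleton_iff, Submodule.eq_top_iff']
  constructor
  · exact fun h f hf => h ⟨f, hf⟩
  · exact fun h f => h f.1 f.2

/-- A projective resolution of a module is a semiprojective resolution. -/
lemma exists_isSemiprojResolution_sgl (M : ModuleCat.{0} R) :
    ∃ (P : Cx R) (π : P ⟶ sgl M), P.IsKProjective ∧ IsSemiprojResolution π := by
  let P := projectiveResolution M
  refine ⟨P.cochainComplex, P.π', inferInstance, inferInstance, ⟨1, fun n hn => ?_⟩,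
    inferInstanceAs (QuasiIso P.π')⟩
  exact CochainComplex.isZero_of_isStrictlyLE _ 0 _ (by omega)

lemma exists_injective_quasiIso (D : Cx R) (a : ℤ) (h : ∀ n < a, IsZero (D.homology n)) :
    ∃ (I : Cx R) (ι : D ⟶ I), QuasiIso ι ∧ (∀ n, Injective (I.X n)) ∧ I.IsKInjective ∧
      ∀ n < a, IsZero (I.X n) := by
  have : D.IsGE a := by
    rw [CochainComplex.isGE_iff]
    intro i hi
    rw [HomologicalComplex.exactAt_iff_isZero_homology]
    exact h i hi
  have : QuasiIso (D.πTruncGE a) := (D.quasiIso_πTruncGE_iff a).2 inferInstance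
  obtain ⟨I, i, _, hI, _⟩ :=
    CochainComplex.Plus.modelCategoryQuillen.exists_quasiIso_injective (D.truncGE a) a
  exact ⟨I, D.πTruncGE a ≫ i, inferInstance, hI, CochainComplex.isKInjective_of_injective I a,
    fun n hn => CochainComplex.isZero_of_isStrictlyGE _ a _ hn⟩

variable [IsLocalRing R]

/-- The data extracted from a dualizing complex: the functor `N ↦ Ext^i(N, D)`. -/
lemma IsNormalizedDualizingComplex.exists_deltaFunctor {D : Cx R}
    (hD : IsNormalizedDualizingComplex R D) :
    ∃ (T : DeltaFunctor R) (a n : ℤ),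
      (∀ i < a, ∀ (N : Type) [AddCommGroup N] [Module R N], Subsingleton (T.obj i N)) ∧
      (∀ i, Nonempty (T.obj i R ≅ D.homology i)) ∧
      (∀ i, i ≠ n → Subsingleton (T.obj i (R ⧸ IsLocalRing.maximalIdeal R))) ∧
      Nontrivial (T.obj n (R ⧸ IsLocalRing.maximalIdeal R)) := by
  obtain ⟨a, ha⟩ := hD.homology_bounded
  obtain ⟨n, hn, hne⟩ := hD.ext_residue
  obtain ⟨I, ι, _, hI, _, hIa⟩ := exists_injective_quasiIso D a ha
  obtain ⟨P, π, _, hπ⟩ :=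
    exists_isSemiprojResolution_sgl (ModuleCat.of R (R ⧸ IsLocalRing.maximalIdeal R))
  have := hπ.2.2
  have key (i : ℤ) : Subsingleton ((homDelta I hI).obj i (R ⧸ IsLocalRing.maximalIdeal R)) ↔
      ∀ f : Cochain P D i, δ i (i + 1) f = 0 → ∃ g : Cochain P D (i - 1), δ (i - 1) i g = f := by
    rw [← subsingleton_cohomologyClass_iff]
    obtain ⟨e⟩ := nonempty_cohomologyClass_equiv π ι i
    exact (subsingleton_cohomologyClass_single_iff _ I i).symm.trans e.subsingleton_congr.symm
  refine ⟨homDelta I hI, a, n, ?_, ?_, ?_, ?_⟩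
  · intro i hi N _ _
    exact homCx_subsingleton_homology_of_isZero I N i (hIa i hi)
  · intro i
    exact ⟨(HomologicalComplex.homologyMapIso (homCxSelfIso I) i) ≪≫
      (asIso (HomologicalComplex.homologyMap ι i)).symm⟩
  · intro i hi
    rw [key]
    exact hne i hi P π hπ
  · rw [← not_subsingleton_iff_nontrivial, key, ← subsingleton_extModule_iff]
    obtain ⟨e⟩ := hn P π hπ
    rw [e.toEquiv.subsingleton_congr, not_subsingleton_iff_nontrivial]
    infer_instance

end Bridge

section ProjectiveResolutionOfComplex

open Opposite

variable {C : Type*} [Category* C] [Abelian C]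

lemma quasiIso_of_quasiIso_opEquivalence_map {K L : CochainComplex C ℤ} (f : K ⟶ L)
    (h : QuasiIso ((CochainComplex.opEquivalence C).functor.map f.op)) : QuasiIso f := by
  rw [← HomologicalComplex.quasiIso_opFunctor_map_iff, quasiIso_iff]
  intro i
  rw [quasiIsoAt_iff' _ (i + 1) i (i - 1) (ComplexShape.prev_eq' _ rfl)
    (ComplexShape.next_eq' _ (sub_add_cancel i 1))]
  have := (quasiIso_iff _).1 h (-i)
  rw [quasiIsoAt_iff' _ (-i - 1) (-i) (-i + 1) (by simp) (by simp)] at this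
  obtain ⟨j, hj⟩ : ∃ j, j = -i := ⟨_, rfl⟩
  obtain rfl : i = -j := by omega
  rw [show -j + 1 = -(j - 1) by ring, show -j - 1 = -(j + 1) by ring]
  rw [neg_neg] at this
  exact this

lemma exists_projective_quasiIso_of_isStrictlyLE [EnoughProjectives C] (K : CochainComplex C ℤ)
    (b : ℤ) [K.IsStrictlyLE b] :
    ∃ (F : CochainComplex C ℤ) (π : F ⟶ K), QuasiIso π ∧ (∀ n, Projective (F.X n)) ∧
      ∀ n, b < n → IsZero (F.X n) := by
  let E := CochainComplex.opEquivalence C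
  have : (E.functor.obj (op K)).IsStrictlyGE (-b) := by
    rw [CochainComplex.isStrictlyGE_iff]
    intro i hi
    exact (K.isZero_of_isStrictlyLE b (-i) (by omega)).op
  obtain ⟨L, i, _, hL, _⟩ :=
    CochainComplex.Plus.modelCategoryQuillen.exists_quasiIso_injective (E.functor.obj (op K)) (-b)
  let F := (E.inverse.obj L).unop
  let e : E.functor.obj (op F) ≅ L := E.counitIso.app L
  let ψ : op K ⟶ op F := E.functor.preimage (i ≫ e.inv)
  let hX (n : ℤ) : op (F.X n) ≅ L.X (-n) := Iso.refl _
  refine ⟨F, ψ.unop, quasiIso_of_quasiIso_opEquivalence_map _ ?_, fun n => ?_, fun n hn => ?_⟩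
  · have : E.functor.map ψ.unop.op = i ≫ e.inv := E.functor.map_preimage _
    change QuasiIso (E.functor.map ψ.unop.op)
    rw [this]
    infer_instance
  · have : Injective (op (F.X n)) := Injective.of_iso (hX n).symm (hL _)
    exact Injective.projective_iff_injective_op.2 this
  · have : IsZero (op (F.X n)) :=
      (CochainComplex.isZero_of_isStrictlyGE L (-b) (-n) (by omega)).of_iso (hX n)
    exact this.unop

end ProjectiveResolutionOfComplex

section TorsionComplex

variable {R : Type} [CommRing R] (U : Submonoid R)

lemma exists_smul_sub_comp_d_eq_zero (F : Cx R) [∀ n, Projective (F.X n)] (b : ℤ)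
    (hb : IsZero (F.X b)) (m : ℕ) (i : ℤ) (him : i + m = b)
    (htors : ∀ j, i < j → j ≤ b → ∃ u ∈ U, u • 𝟙 (F.homology j) = 0) :
    ∃ σ ∈ U, ∃ h : F.X (i + 1) ⟶ F.X i,
      (σ • 𝟙 (F.X i) - F.d i (i + 1) ≫ h) ≫ F.d i (i + 1) = 0 := by
  induction m generalizing i with
  | zero =>
    obtain rfl : i = b := by simpa using him
    exact ⟨1, U.one_mem, 0, hb.eq_of_src _ _⟩
  | succ m ih =>
    obtain ⟨σ, hσ, h, hh⟩ := ih (i + 1) (by push_cast at him; omega)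
      (fun j hj hjb => htors j (by omega) hjb)
    obtain ⟨u, hu, hu0⟩ := htors (i + 1) (by omega) (by push_cast at him; omega)
    let l := F.liftCycles _ _ (by simp) hh
    have hl : l ≫ F.iCycles (i + 1) = _ := F.liftCycles_i _ _ _ _
    have hex := ShortComplex.exact_of_g_is_cokernel
      (ShortComplex.mk (F.toCycles i (i + 1)) (F.homologyπ (i + 1)) (by simp))
      (F.homologyIsCokernel i (i + 1) (by simp))
    have hl0 : (u • l) ≫ F.homologyπ (i + 1) = 0 := by
      rw [← Category.comp_id (F.homologyπ (i + 1)), ← Category.assoc, Linear.smul_comp,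
        Linear.smul_comp, ← Linear.comp_smul, hu0, comp_zero]
    let h' : F.X (i + 1) ⟶ F.X i := hex.liftFromProjective (u • l) hl0
    have hh' : h' ≫ F.toCycles i (i + 1) = u • l := hex.liftFromProjective_comp _ _
    have hd : h' ≫ F.d i (i + 1) =
        u • (σ • 𝟙 (F.X (i + 1)) - F.d (i + 1) (i + 1 + 1) ≫ h) := by
      rw [← hl, ← F.toCycles_i, ← Category.assoc, hh', Linear.smul_comp]
    refine ⟨u * σ, U.mul_mem hu hσ, h', ?_⟩
    rw [Preadditive.sub_comp, Category.assoc, hd]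
    simp [smul_sub, Preadditive.comp_sub, mul_smul]

lemma exists_forall_ne_d_comp (F : Cx R) [∀ n, Projective (F.X n)] (b : ℤ)
    (hb : IsZero (F.X b)) (m : ℕ) (i : ℤ) (him : i + m = b)
    (htors : ∀ j, i < j → j ≤ b → ∃ u ∈ U, u • 𝟙 (F.homology j) = 0) {N : ModuleCat.{0} R}
    (α : F.homology i ⟶ N) (hα : ∀ u ∈ U, u • α ≠ 0) :
    ∃ φ : F.X i ⟶ N, F.d (i - 1) i ≫ φ = 0 ∧ ∀ g : F.X (i + 1) ⟶ N, F.d i (i + 1) ≫ g ≠ φ := by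
  obtain ⟨σ, hσ, h, hh⟩ := exists_smul_sub_comp_d_eq_zero U F b hb m i him htors
  let l := F.liftCycles _ _ (by simp) hh
  have hl : l ≫ F.iCycles i = _ := F.liftCycles_i _ _ _ _
  have h1 : F.d (i - 1) i ≫ l = σ • F.toCycles (i - 1) i := by
    rw [← cancel_mono (F.iCycles i), Category.assoc, hl]
    simp [Preadditive.comp_sub]
  have h2 : F.iCycles i ≫ l = σ • 𝟙 _ := by
    rw [← cancel_mono (F.iCycles i), Category.assoc, hl]
    simp [Preadditive.comp_sub]
  refine ⟨l ≫ F.homologyπ i ≫ α, ?_, fun g hg => hα σ hσ ?_⟩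
  · rw [reassoc_of% h1]
    simp
  · have h3 : F.iCycles i ≫ l ≫ F.homologyπ i ≫ α = 0 := by
      rw [← hg]
      simp
    rw [reassoc_of% h2] at h3
    rw [← cancel_epi (F.homologyπ i)]
    simpa using h3

lemma not_extVanishes_sgl {D F : Cx R} (π : F ⟶ D) (hπ : IsSemiprojResolution π) (b : ℤ)
    (hb : IsZero (F.X b)) (s : ℤ) (hs : -s ≤ b)
    (htors : ∀ j, -s < j → ∃ u ∈ U, u • 𝟙 (F.homology j) = 0) (N : ModuleCat.{0} R)
    (α : F.homology (-s) ⟶ N) (hα : ∀ u ∈ U, u • α ≠ 0) : ¬ ExtVanishes D (sgl N) s := by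
  intro h
  have := hπ.1
  obtain ⟨φ, hφ, hg⟩ := exists_forall_ne_d_comp U F b hb (b + s).toNat (-s) (by omega)
    (fun j hj _ => htors j hj) α hα
  let z := Cocycle.toSingleMk φ (q := 0) (neg_add_cancel s) (-s - 1) (by ring) hφ
  have hz : z ∈ coboundaries _ _ _ := by
    rw [mem_coboundaries_iff _ (s - 1) (by simp)]
    exact h F π hπ z.1 (z.δ_eq_zero _)
  obtain ⟨g, hg'⟩ := (Cocycle.toSingleMk_mem_coboundaries_iff φ (q := 0) (neg_add_cancel s)
    (-s - 1) (by ring) hφ (-s + 1) rfl).1 hz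
  exact hg g hg'

end TorsionComplex

section MinimalPrime

variable {R : Type} [CommRing R] [IsNoetherianRing R]

lemma exists_linearMap_of_not_isTors (p : Ideal R) [p.IsPrime] (hp : p ∈ minimalPrimes R)
    (M : Type) [AddCommGroup M] [Module R M] [Module.Finite R M]
    (hM : ¬ IsTors p.primeCompl M) :
    ∃ α : M →ₗ[R] R, ∀ u ∈ p.primeCompl, u • α ≠ 0 := by
  let A := Localization.AtPrime p
  let N := LocalizedModule p.primeCompl M
  have : Nontrivial N := by
    by_contra hN
    rw [not_nontrivial_iff_subsingleton, LocalizedModule.subsingleton_iff] at hN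
    exact hM hN
  have hN : IsCoatomic (Submodule A N) := inferInstance
  obtain ⟨W, hW⟩ := hN.exists_coatom
  have : IsSimpleModule A (N ⧸ W) := isSimpleModule_iff_isCoatom.2 hW
  obtain ⟨J, hJ, ⟨e⟩⟩ := isSimpleModule_iff_quot_maximal.1 this
  obtain rfl := IsLocalRing.eq_maximalIdeal hJ
  have hass : p ∈ associatedPrimes R R := by
    apply Module.associatedPrimes.minimalPrimes_annihilator_subset_associatedPrimes R R
    rwa [Module.annihilator_eq_bot.2 inferInstance]
  obtain ⟨-, x, hx⟩ := Submodule.isAssociatedPrime_iff.1 hass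
  have hpx (a : R) : a ∈ p ↔ a * x = 0 := by
    conv_lhs => rw [hx]
    simp [Submodule.mem_colon_singleton]
  let y : A := algebraMap R A x
  have hy : y ≠ 0 := by
    intro h0
    obtain ⟨u, hu⟩ := (IsLocalization.map_eq_zero_iff p.primeCompl A x).1 h0
    exact u.2 ((hpx _).2 hu)
  have hle : IsLocalRing.maximalIdeal A ≤ LinearMap.ker (LinearMap.toSpanSingleton A A y) := by
    rw [← Localization.AtPrime.map_eq_maximalIdeal, Ideal.map_le_iff_le_comap]
    intro a ha
    simp [y, A, ← map_mul, (hpx a).1 ha]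
  let g : N →ₗ[A] A := Submodule.liftQ _ _ hle ∘ₗ e.toLinearMap ∘ₗ W.mkQ
  have hg : g ≠ 0 := by
    intro h0
    obtain ⟨n, hn⟩ := W.mkQ_surjective (e.symm (Submodule.Quotient.mk 1))
    have hgn : g n = y := by
      simp only [g, LinearMap.comp_apply, hn, LinearEquiv.coe_coe, LinearEquiv.apply_symm_apply]
      exact (Submodule.liftQ_apply _ _ _).trans (by simp)
    exact hy (by rw [← hgn, h0, LinearMap.zero_apply])
  have := Module.finitePresentation_of_finite R M
  obtain ⟨α, t, hα⟩ := Module.FinitePresentation.exists_lift_of_isLocalizedModule p.primeCompl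
    (Algebra.linearMap R A) (g.restrictScalars R ∘ₗ LocalizedModule.mkLinearMap p.primeCompl M)
  refine ⟨α, fun u hu h0 => hg ?_⟩
  have hunit : ∀ v ∈ p.primeCompl, ∀ z : A, v • z = 0 → z = 0 := fun v hv z hz => by
    rw [Algebra.smul_def] at hz
    exact (IsLocalization.map_units A (⟨v, hv⟩ : p.primeCompl)).mul_right_eq_zero.1 hz
  have hmk (m : M) : g (LocalizedModule.mk m 1) = 0 := by
    refine hunit t t.2 _ (hunit u hu _ ?_)
    have h1 : algebraMap R A (α m) = (t : R) • g (LocalizedModule.mk m 1) :=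
      LinearMap.congr_fun hα m
    rw [← h1, Algebra.smul_def, ← map_mul]
    have h2 : u * α m = 0 := LinearMap.congr_fun h0 m
    rw [h2, map_zero]
  ext n
  induction n using LocalizedModule.induction_on with
  | _ m v =>
    refine hunit v v.2 _ ?_
    rw [← LinearMap.map_smul_of_tower g (v : R)]
    have : (v : R) • LocalizedModule.mk m v = LocalizedModule.mk m 1 := by
      rw [LocalizedModule.smul'_mk]
      exact LocalizedModule.mk_cancel v m
    rw [this, hmk]

end MinimalPrime

section Depth

variable {R : Type} [CommRing R]

lemma isZero_ext_iff_forall (X Y : ModuleCat.{0} R) (n : ℕ) (P : ProjectiveResolution X) :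
    IsZero (((Ext R (ModuleCat.{0} R) n).obj (Opposite.op X)).obj Y) ↔
      ∀ f : P.complex.X n ⟶ Y, P.complex.d (n + 1) n ≫ f = 0 →
        ∃ g : P.complex.X ((ComplexShape.up ℕ).prev n) ⟶ Y,
          P.complex.d n ((ComplexShape.up ℕ).prev n) ≫ g = f := by
  rw [(P.isoExt n Y).isZero_iff, ← HomologicalComplex.exactAt_iff_isZero_homology,
    HomologicalComplex.exactAt_iff' _ ((ComplexShape.up ℕ).prev n) n (n + 1) rfl (by simp),
    ShortComplex.moduleCat_exact_iff]
  rfl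

lemma subsingleton_ext_iff_forall (X Y : ModuleCat.{0} R) (n : ℕ) (P : ProjectiveResolution X) :
    Subsingleton (Abelian.Ext X Y n) ↔
      ∀ f : P.complex.X n ⟶ Y, P.complex.d (n + 1) n ≫ f = 0 →
        ∃ g : P.complex.X ((ComplexShape.up ℕ).prev n) ⟶ Y,
          P.complex.d n ((ComplexShape.up ℕ).prev n) ≫ g = f := by
  have key (f : P.complex.X n ⟶ Y) (hf : P.complex.d (n + 1) n ≫ f = 0) :
      P.extMk f (n + 1) rfl hf = 0 ↔ ∃ g : P.complex.X ((ComplexShape.up ℕ).prev n) ⟶ Y,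
        P.complex.d n ((ComplexShape.up ℕ).prev n) ≫ g = f := by
    cases n with
    | zero =>
      have hd : P.complex.d 0 ((ComplexShape.up ℕ).prev 0) = 0 := by simp
      rw [hd]
      rw [← P.extEquivCohomologyClass.apply_eq_iff_eq, P.extEquivCohomologyClass_extMk,
        P.extEquivCohomologyClass_zero, CohomologyClass.mk_eq_zero_iff,
        Cocycle.toSingleMk_mem_coboundaries_iff _ _ _ _ _ 1 (by simp)]
      have h1 : IsZero (P.cochainComplex.X 1) :=
        CochainComplex.isZero_of_isStrictlyLE _ 0 _ (by omega)
      constructor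
      · rintro ⟨g, hg⟩
        refine ⟨0, ?_⟩
        rw [h1.eq_of_src g 0, comp_zero] at hg
        rw [← cancel_epi (P.cochainComplexXIso (-(0 : ℕ)) 0 rfl).hom, ← hg]
        simp
      · rintro ⟨g, hg⟩
        refine ⟨0, ?_⟩
        rw [← hg]
        simp
    | succ n =>
      have hp : (ComplexShape.up ℕ).prev (n + 1) = n := by simp
      rw [hp]
      exact P.extMk_eq_zero_iff f (n + 2) rfl hf n rfl
  constructor
  · intro h f hf
    rw [← key f hf]
    exact h.elim _ _
  · intro h
    refine subsingleton_of_forall_eq 0 fun x => ?_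
    obtain ⟨f, hf, rfl⟩ := P.extMk_surjective x (n + 1) rfl
    exact (key f hf).2 (h f hf)

lemma isZero_ext_iff_subsingleton (X Y : ModuleCat.{0} R) (n : ℕ) :
    IsZero (((Ext R (ModuleCat.{0} R) n).obj (Opposite.op X)).obj Y) ↔
      Subsingleton (Abelian.Ext X Y n) := by
  rw [isZero_ext_iff_forall X Y n (projectiveResolution X),
    subsingleton_ext_iff_forall X Y n (projectiveResolution X)]

variable [IsLocalRing R] [IsNoetherianRing R]

open IsLocalRing in
lemma isCohenMacaulayLocalRing_of_isRegular (e : ℕ) (he : ringKrullDim R = e) (rs : List R)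
    (hlen : rs.length = e) (hmem : ∀ r ∈ rs, r ∈ maximalIdeal R)
    (hreg : RingTheory.Sequence.IsRegular R rs) : IsCohenMacaulayLocalRing R := by
  have hsupp : Module.support R (ModuleCat.of R (R ⧸ maximalIdeal R)) =
      PrimeSpectrum.zeroLocus (maximalIdeal R : Set R) := by
    rw [Module.support_eq_zeroLocus]
    simp [Ideal.annihilator_quotient]
  have hlt : maximalIdeal R • (⊤ : Submodule R (ModuleCat.of R R)) < ⊤ := by
    rw [smul_eq_mul, Ideal.mul_top]
    exact lt_top_iff_ne_top.2 (maximalIdeal.isMaximal R).ne_top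
  have hlow := ModuleCat.subsingleton_ext_of_exists_isRegular (maximalIdeal R)
    (ModuleCat.of R (R ⧸ maximalIdeal R)) hsupp.le (ModuleCat.of R R) hlt rs hmem hreg
  have hhigh : ¬ Subsingleton (Abelian.Ext (ModuleCat.of R (R ⧸ maximalIdeal R))
      (ModuleCat.of R R) e) := by
    intro h
    obtain ⟨ss, hss, -, hr⟩ := ModuleCat.exists_isRegular_of_exists_subsingleton_ext
      (maximalIdeal R) (e + 1) (ModuleCat.of R R) hlt (ModuleCat.of R (R ⧸ maximalIdeal R)) hsupp
      (fun i hi => by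
        rcases Nat.lt_succ_iff_lt_or_eq.1 hi with hi | rfl
        · exact hlow i (hlen ▸ hi)
        · exact h)
    have hdim := ringKrullDim_add_length_eq_ringKrullDim_of_isRegular ss hr
    have : Nontrivial (R ⧸ Ideal.ofList ss) := by
      rw [Ideal.Quotient.nontrivial_iff]
      intro htop
      exact hr.top_ne_smul (by rw [htop]; simp)
    have h0 := ringKrullDim_nonneg_of_nontrivial (R := R ⧸ Ideal.ofList ss)
    rw [he, hss] at hdim
    have h1 : ((e + 1 : ℕ) : WithBot ℕ∞) ≤ e := by
      rw [← hdim]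
      exact le_add_of_nonneg_left h0
    exact absurd (Nat.cast_le.1 h1) (by omega)
  have hdepth : ringDepth R = e := by
    refine le_antisymm (sInf_le ⟨e, rfl, ?_⟩) (le_sInf ?_)
    · rwa [isZero_ext_iff_subsingleton]
    · rintro _ ⟨i, rfl, hi⟩
      rw [isZero_ext_iff_subsingleton] at hi
      by_contra hlt
      exact hi (hlow i (by rw [hlen]; exact_mod_cast not_le.1 hlt))
  rw [IsCohenMacaulayLocalRing, hdepth, he]
  rfl

end Depth

lemma exists_isSemiprojResolution_of_isLE {R : Type} [CommRing R] (D : Cx R) (b : ℤ) [D.IsLE b] :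
    ∃ (F : Cx R) (π : F ⟶ D), IsSemiprojResolution π ∧ ∀ n, b < n → IsZero (F.X n) := by
  obtain ⟨F, π, _, hF, hFb⟩ := exists_projective_quasiIso_of_isStrictlyLE (D.truncLE b) b
  exact ⟨F, π ≫ D.ιTruncLE b, ⟨hF, ⟨b + 1, fun n hn => hFb n (by omega)⟩, inferInstance⟩, hFb⟩

/-- If `(R, 𝔪, k)` is a commutative noetherian local ring with a
normalized dualizing complex `D` and `Ext^i_R(D, R) = 0` for all `1 ≤ i ≤ dim R`,
then `R` is Cohen-Macaulay. -/
theorem isCohenMacaulay_of_ext_dualizing_vanishes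
    (R : Type) [CommRing R] [IsNoetherianRing R] [IsLocalRing R]
    (D : Cx R) (hD : IsNormalizedDualizingComplex R D)
    (hvan : ∀ i : ℕ, 1 ≤ i → (i : WithBot ℕ∞) ≤ ringKrullDim R →
      ExtVanishes D (sgl (ModuleCat.of R R)) (i : ℤ)) :
    IsCohenMacaulayLocalRing R := by
  obtain ⟨T, a, n, hlow, hiso, hk, hkn⟩ := hD.exists_deltaFunctor
  have hfin (i : ℤ) : Module.Finite R (T.obj i R) :=
    have := hD.finite_homology i
    Module.Finite.equiv (hiso i).some.toLinearEquiv.symm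
  have hft (i : ℤ) (N : Type) [AddCommGroup N] [Module R N] [Module.Finite R N] :
      Module.Finite R (T.obj i N) := T.finite_obj a hlow hfin i N
  have hhigh (i : ℤ) (hi : 0 < i) : Subsingleton (T.obj i R) :=
    ModuleCat.subsingleton_of_isZero ((hD.vanish_neg i hi).of_iso (hiso i).some)
  have hnontriv : Nontrivial (T.obj 0 R) := by
    by_contra h
    rw [not_nontrivial_iff_subsingleton] at h
    exact hD.nonzero_zero ((ModuleCat.isZero_of_subsingleton _).of_iso (hiso 0).some.symm)
  obtain ⟨e, he⟩ : ∃ e : ℕ, ringKrullDim R = e :=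
    ⟨_, Order.krullDim_eq_length_of_finiteDimensionalOrder⟩
  obtain ⟨hn0, hne⟩ := T.sub_le_of_nontrivial hft n hk 0 e he hnontriv
  obtain hn | hn : n = e ∨ n < e := by omega
  · obtain ⟨rs, hlen, hmem, hreg⟩ := T.exists_isRegular hft n hk hkn e R
      (fun i hi => hhigh i (by omega))
    exact isCohenMacaulayLocalRing_of_isRegular e he rs hlen hmem hreg
  · exfalso
    obtain ⟨s, hs⟩ := Int.eq_ofNat_of_zero_le (a := e - n) (by omega)
    obtain ⟨p, hp, _, hpn, hpi⟩ := T.exists_minimal_prime hft n hk hkn a 0 hlow hhigh e he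
    have : D.IsLE 0 := D.isLE_iff 0 |>.2 fun i hi =>
      (D.exactAt_iff_isZero_homology i).2 (hD.vanish_neg i hi)
    obtain ⟨F, π, hπ, hF⟩ := exists_isSemiprojResolution_of_isLE D 0
    have := hπ.2.2
    let φ (i : ℤ) : F.homology i ≅ T.obj i R := isoOfQuasiIsoAt π i ≪≫ (hiso i).some.symm
    obtain ⟨α, hα⟩ := exists_linearMap_of_not_isTors p hp (T.obj (-s) R)
      (by rwa [show n - e = -(s : ℤ) by omega] at hpn)
    refine not_extVanishes_sgl p.primeCompl π hπ 1 (hF 1 one_pos) s (by omega) (fun j hj => ?_)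
      (ModuleCat.of R R) ((φ _).hom ≫ ModuleCat.ofHom α) (fun u hu h0 => hα u hu ?_)
      (hvan s (by omega) (by rw [he]; exact_mod_cast (by omega : s ≤ e)))
    · obtain ⟨u, hu, hu0⟩ := (hpi j (by omega)).exists_forall_smul_eq_zero
      refine ⟨u, hu, ?_⟩
      have : u • 𝟙 (T.obj j R) = 0 := ModuleCat.hom_ext (LinearMap.ext hu0)
      rw [← (φ j).hom_inv_id, ← Category.id_comp (φ j).inv, ← Linear.comp_smul,
        ← Linear.smul_comp, this, zero_comp, comp_zero]
    · rw [← Linear.comp_smul, ← cancel_epi (φ _).inv, Iso.inv_hom_id_assoc, comp_zero] at h0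
      exact ModuleCat.hom_ext_iff.1 h0
end
end
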